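/- arXiv:2407.05522 — 9 statements merged into one kernel-verified Lean document; each statement's English description precedes it below -/
import Mathlib

section
/- Let E be an ordered Banach space with normal positive cone E₊, let (S(t))_{t≥0} be a positive C₀-semigroup on E, let u̲ ≤ ū in E, let F : [u̲,ū] → E be continuous and increasing, fix u₀ ∈ [u̲,ū], and let G be the fixed-point map associated with u₀. If (uₙ) and u are strongly measurable functions from [0,∞) to E with values in [u̲,ū] a.e. and ∫₀ᵀ ‖uₙ(t) − u(t)‖ dt → 0 for every T > 0, then ∫₀ᵀ ‖G(uₙ)(t) − G(u)(t)‖ dt → 0 for every T > 0. -/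
open MeasureTheory Filter Topology

noncomputable section

/-- A proper closed positive cone in a real normed space. -/
def IsProperCone {E : Type*} [NormedAddCommGroup E] [NormedSpace ℝ E] (P : Set E) : Prop :=
  IsClosed P ∧ (∀ x ∈ P, ∀ y ∈ P, x + y ∈ P) ∧
    (∀ t : ℝ, 0 ≤ t → ∀ x ∈ P, t • x ∈ P) ∧ (∀ x ∈ P, -x ∈ P → x = 0)

/-- The partial order induced by the cone `P`: `x ≤ y` iff `y - x ∈ P`. -/
def coneLE {E : Type*} [NormedAddCommGroup E] (P : Set E) (x y : E) : Prop := y - x ∈ P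

/-- The order interval `[a, b]` with respect to the cone `P`. -/
def orderInterval {E : Type*} [NormedAddCommGroup E] (P : Set E) (a b : E) : Set E :=
  {x | coneLE P a x ∧ coneLE P x b}

/-- The cone is normal iff every order interval is norm bounded. -/
def IsNormalCone {E : Type*} [NormedAddCommGroup E] (P : Set E) : Prop :=
  ∀ a b : E, ∃ C : ℝ, ∀ x ∈ orderInterval P a b, ‖x‖ ≤ C

/-- `E` has order continuous norm: every increasing sequence contained in some
order interval converges in norm. -/
def OrderContinuousNorm {E : Type*} [NormedAddCommGroup E] (P : Set E) : Prop :=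
  ∀ (x : ℕ → E) (a b : E), (∀ n, coneLE P (x n) (x (n + 1))) →
    (∀ n, x n ∈ orderInterval P a b) → ∃ l : E, Filter.Tendsto x Filter.atTop (nhds l)

/-- A C₀-semigroup on `E`. -/
def IsC0Semigroup {E : Type*} [NormedAddCommGroup E] [NormedSpace ℝ E]
    (S : ℝ → E →L[ℝ] E) : Prop :=
  S 0 = 1 ∧ (∀ s t : ℝ, 0 ≤ s → 0 ≤ t → S (s + t) = (S s).comp (S t)) ∧
    ∀ x : E, ContinuousOn (fun t => S t x) (Set.Ici 0)

/-- A positive C₀-semigroup with respect to the cone `P`. -/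
def IsPositiveSemigroup {E : Type*} [NormedAddCommGroup E] [NormedSpace ℝ E]
    (P : Set E) (S : ℝ → E →L[ℝ] E) : Prop :=
  IsC0Semigroup S ∧ ∀ t : ℝ, 0 ≤ t → ∀ x ∈ P, S t x ∈ P

/-- The fixed point map `G` associated with the initial value `u0`:
`G(u)(t) = S(t)u₀ + ∫₀ᵗ S(t−s)F(u(s)) ds`. -/
def fixedPointMap {E : Type*} [NormedAddCommGroup E] [NormedSpace ℝ E]
    (S : ℝ → E →L[ℝ] E) (F : E → E) (u0 : E) (u : ℝ → E) (t : ℝ) : E :=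
  S t u0 + ∫ s in (0:ℝ)..t, S (t - s) (F (u s))

/-- A mild solution with values in `[ua, ub]` and initial value `u0`. -/
def IsMildSolution {E : Type*} [NormedAddCommGroup E] [NormedSpace ℝ E]
    (P : Set E) (S : ℝ → E →L[ℝ] E) (F : E → E) (ua ub u0 : E) (u : ℝ → E) : Prop :=
  ContinuousOn u (Set.Ici 0) ∧ (∀ t : ℝ, 0 ≤ t → u t ∈ orderInterval P ua ub) ∧
    ∀ t : ℝ, 0 ≤ t → u t = fixedPointMap S F u0 u t

theorem aux_measF {E : Type*} [NormedAddCommGroup E] {I : Set E} (hI : IsClosed I) {a : E}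
    (ha : a ∈ I) {F : E → E} (hF : ContinuousOn F I) {μ : Measure ℝ} {w : ℝ → E}
    (hw : AEStronglyMeasurable w μ) (hwI : ∀ᵐ s ∂μ, w s ∈ I) :
    AEStronglyMeasurable (fun s => F (w s)) μ := by
  classical
  let w' : ℝ → I := fun s => if h : w s ∈ I then ⟨w s, h⟩ else ⟨a, ha⟩
  have h1 : ∀ᵐ s ∂μ, w s = (w' s : E) := by
    filter_upwards [hwI] with s hs
    simp [w', hs]
  have h2 : AEStronglyMeasurable (fun s => ((w' s : I) : E)) μ := hw.congr h1
  have h3 : AEStronglyMeasurable w' μ :=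
    (Topology.IsEmbedding.subtypeVal (p := fun x => x ∈ I)).aestronglyMeasurable_comp_iff.1 h2
  have h4 := (continuousOn_iff_continuous_domRestrict.1 hF).comp_aestronglyMeasurable h3
  refine h4.congr ?_
  filter_upwards [h1] with s hs
  simp [hs]

theorem aux_L1 {E : Type*} [NormedAddCommGroup E] {I : Set E} (hI : IsClosed I) {a : E}
    (ha : a ∈ I) {F : E → E} (hF : ContinuousOn F I) {μ : Measure ℝ} [IsFiniteMeasure μ]
    {C D : ℝ} (hC : ∀ x ∈ I, ‖F x‖ ≤ C) (hD : ∀ x ∈ I, ‖x‖ ≤ D)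
    {u : ℕ → ℝ → E} {v : ℝ → E}
    (hu : ∀ n, AEStronglyMeasurable (u n) μ) (huI : ∀ n, ∀ᵐ s ∂μ, u n s ∈ I)
    (hv : AEStronglyMeasurable v μ) (hvI : ∀ᵐ s ∂μ, v s ∈ I)
    (hc : Tendsto (fun n => ∫ s, ‖u n s - v s‖ ∂μ) atTop (𝓝 0)) :
    Tendsto (fun n => ∫ s, ‖F (u n s) - F (v s)‖ ∂μ) atTop (𝓝 0) := by
  apply tendsto_of_subseq_tendsto
  intro ns hns
  have hm : TendstoInMeasure μ (fun k => u (ns k)) atTop v := by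
    refine tendstoInMeasure_of_tendsto_eLpNorm (p := 1) one_ne_zero (fun k => hu _) hv ?_
    have := (ENNReal.tendsto_ofReal (hc.comp hns))
    rw [ENNReal.ofReal_zero] at this
    refine this.congr fun k => ?_
    have hint : Integrable (fun s => u (ns k) s - v s) μ :=
      (Integrable.of_bound (hu _) D ((huI _).mono fun s hs => hD _ hs)).sub
        (Integrable.of_bound hv D (hvI.mono fun s hs => hD _ hs))
    rw [eLpNorm_one_eq_lintegral_enorm]
    exact ofReal_integral_norm_eq_lintegral_enorm hint
  obtain ⟨ms, hms, hae⟩ := hm.exists_seq_tendsto_ae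
  refine ⟨ms, ?_⟩
  have := tendsto_integral_of_dominated_convergence (μ := μ)
    (F := fun k s => ‖F (u (ns (ms k)) s) - F (v s)‖) (f := fun _ => (0:ℝ)) (fun _ => C + C)
    (fun k => ((aux_measF hI ha hF (hu _) (huI _)).sub (aux_measF hI ha hF hv hvI)).norm)
    (integrable_const _) ?_ ?_
  · simpa using this
  · intro k
    filter_upwards [huI (ns (ms k)), hvI] with s h1 h2
    rw [norm_norm]
    exact (norm_sub_le _ _).trans (add_le_add (hC _ h1) (hC _ h2))
  · filter_upwards [hae, hvI, ae_all_iff.2 huI] with s h1 h2 h3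
    have h4 : Tendsto (fun k => u (ns (ms k)) s) atTop (𝓝[I] (v s)) :=
      tendsto_nhdsWithin_iff.2 ⟨h1, Eventually.of_forall fun k => h3 _⟩
    have h5 := (hF _ h2).tendsto.comp h4
    have h6 := (h5.sub_const (F (v s))).norm
    simpa using h6

theorem aux_bound {E : Type*} [NormedAddCommGroup E] [NormedSpace ℝ E] [CompleteSpace E]
    {S : ℝ → E →L[ℝ] E} (hS : IsC0Semigroup S) (T : ℝ) (hT : 0 < T) :
    ∃ M : ℝ, 0 ≤ M ∧ (∀ t ∈ Set.Icc 0 T, ‖S t‖ ≤ M) ∧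
      Continuous (fun p : ℝ × E => S (max 0 (min p.1 T)) p.2) := by
  have hc : ∀ x : E, Continuous fun t : ℝ => S (max 0 (min t T)) x := fun x =>
    (hS.2.2 x).comp_continuous (by fun_prop) (fun t => Set.mem_Ici.2 (le_max_left _ _))
  obtain ⟨M, hM⟩ := banach_steinhaus (g := fun t : Set.Icc (0:ℝ) T => S t) (by
    intro x
    obtain ⟨C, hC⟩ := (isCompact_Icc (a := (0:ℝ)) (b := T)).exists_bound_of_continuousOn
      ((hS.2.2 x).mono fun t ht => ht.1)
    exact ⟨C, fun i => hC i i.2⟩)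
  have hM0 : 0 ≤ M := (norm_nonneg _).trans (hM ⟨0, le_rfl, hT.le⟩)
  refine ⟨M, hM0, fun t ht => hM ⟨t, ht⟩, ?_⟩
  refine continuous_prod_of_continuous_lipschitzWith' _ ⟨M, hM0⟩ (fun t => ?_) hc
  refine (S (max 0 (min t T))).lipschitz.weaken ?_
  exact hM ⟨max 0 (min t T), le_max_left _ _, max_le hT.le (min_le_right _ _)⟩

/-- the fixed point map `G` is continuous with respect to local
`L¹` convergence of interval-valued functions. -/
theorem fixedPointMap_continuous_L1loc
    {E : Type*} [NormedAddCommGroup E] [NormedSpace ℝ E] [CompleteSpace E]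
    (P : Set E) (S : ℝ → E →L[ℝ] E) (F : E → E) (ua ub u0 : E)
    (hP : IsProperCone P) (hN : IsNormalCone P) (hS : IsPositiveSemigroup P S)
    (hab : coneLE P ua ub)
    (hFc : ContinuousOn F (orderInterval P ua ub))
    (hFm : ∀ x ∈ orderInterval P ua ub, ∀ y ∈ orderInterval P ua ub,
      coneLE P x y → coneLE P (F x) (F y))
    (hu0 : u0 ∈ orderInterval P ua ub)
    (u : ℕ → ℝ → E) (v : ℝ → E)
    (hmeas : ∀ n, AEStronglyMeasurable (u n) (volume.restrict (Set.Ici (0:ℝ))))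
    (hvmeas : AEStronglyMeasurable v (volume.restrict (Set.Ici (0:ℝ))))
    (hval : ∀ n, ∀ᵐ s ∂volume.restrict (Set.Ici (0:ℝ)), u n s ∈ orderInterval P ua ub)
    (hvval : ∀ᵐ s ∂volume.restrict (Set.Ici (0:ℝ)), v s ∈ orderInterval P ua ub)
    (hconv : ∀ T : ℝ, 0 < T →
      Filter.Tendsto (fun n => ∫ t in (0:ℝ)..T, ‖u n t - v t‖) Filter.atTop (nhds 0)) :
    ∀ T : ℝ, 0 < T →
      Filter.Tendsto
        (fun n => ∫ t in (0:ℝ)..T, ‖fixedPointMap S F u0 (u n) t - fixedPointMap S F u0 v t‖)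
        Filter.atTop (nhds 0) := by
  intro T hT
  obtain ⟨M, hM0, hM, hcont⟩ := aux_bound hS.1 T hT
  obtain ⟨D, hD⟩ := hN ua ub
  obtain ⟨C, hC'⟩ := hN (F ua) (F ub)
  have h0 : (0:E) ∈ P := by simpa using hP.2.2.1 0 le_rfl _ hab
  have hua : ua ∈ orderInterval P ua ub := ⟨by simpa [coneLE] using h0, hab⟩
  have hub : ub ∈ orderInterval P ua ub := ⟨hab, by simpa [coneLE] using h0⟩
  have hC : ∀ x ∈ orderInterval P ua ub, ‖F x‖ ≤ C := fun x hx =>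
    hC' _ ⟨hFm _ hua _ hx hx.1, hFm _ hx _ hub hx.2⟩
  have hI : IsClosed (orderInterval P ua ub) :=
    (hP.1.preimage (f := fun x => x - ua) (by fun_prop)).inter
      (hP.1.preimage (f := fun x => ub - x) (by fun_prop))
  have hle : ∀ t : ℝ, volume.restrict (Set.Ioc 0 t) ≤ volume.restrict (Set.Ici (0:ℝ)) :=
    fun t => Measure.restrict_mono (fun s hs => hs.1.le) le_rfl
  have key : Tendsto (fun n => ∫ s in Set.Ioc 0 T, ‖F (u n s) - F (v s)‖) atTop (𝓝 0) := by
    refine aux_L1 hI hua hFc hC hD (fun n => (hmeas n).mono_measure (hle T))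
      (fun n => ae_mono (hle T) (hval n)) (hvmeas.mono_measure (hle T))
      (ae_mono (hle T) hvval) ?_
    simpa only [intervalIntegral.integral_of_le hT.le] using hconv T hT
  have hFint : ∀ w : ℝ → E, AEStronglyMeasurable w (volume.restrict (Set.Ici (0:ℝ))) →
      (∀ᵐ s ∂volume.restrict (Set.Ici (0:ℝ)), w s ∈ orderInterval P ua ub) → ∀ t : ℝ,
      IntegrableOn (fun s => F (w s)) (Set.Ioc 0 t) := by
    intro w hw hwI t
    refine Integrable.of_bound ((aux_measF hI hua hFc hw hwI).mono_measure (hle t)) C ?_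
    have hw2 : ∀ᵐ s ∂volume.restrict (Set.Ioc 0 t), w s ∈ orderInterval P ua ub :=
      ae_mono (hle t) hwI
    exact hw2.mono fun s hs => hC _ hs
  have hSint : ∀ w : ℝ → E, AEStronglyMeasurable w (volume.restrict (Set.Ici (0:ℝ))) →
      (∀ᵐ s ∂volume.restrict (Set.Ici (0:ℝ)), w s ∈ orderInterval P ua ub) →
      ∀ t ∈ Set.Icc 0 T,
      IntegrableOn (fun s => S (t - s) (F (w s))) (Set.Ioc 0 t) := by
    intro w hw hwI t ht
    have hFi := hFint w hw hwI t
    have hin : ∀ᵐ s ∂volume.restrict (Set.Ioc 0 t), s ∈ Set.Ioc 0 t :=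
      ae_restrict_mem measurableSet_Ioc
    have hm : AEStronglyMeasurable (fun s => S (t - s) (F (w s)))
        (volume.restrict (Set.Ioc 0 t)) := by
      have h1 : AEStronglyMeasurable (fun s : ℝ => (t - s, F (w s)))
          (volume.restrict (Set.Ioc 0 t)) :=
        (Continuous.aestronglyMeasurable (by fun_prop)).prodMk hFi.aestronglyMeasurable
      refine (hcont.comp_aestronglyMeasurable h1).congr ?_
      filter_upwards [hin] with s hs
      have e : max 0 (min (t - s) T) = t - s := by
        rw [min_eq_left (by linarith [hs.1, ht.2]), max_eq_right (by linarith [hs.2])]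
      simp only [e]
    refine Integrable.mono' (hFi.norm.const_mul M) hm ?_
    filter_upwards [hin] with s hs
    exact (S (t - s)).le_of_opNorm_le
      (hM _ ⟨by linarith [hs.2], by linarith [hs.1, ht.2]⟩) _
  have bound : ∀ n, ∀ t ∈ Set.Ioc 0 T,
      ‖fixedPointMap S F u0 (u n) t - fixedPointMap S F u0 v t‖ ≤
        M * ∫ s in Set.Ioc 0 T, ‖F (u n s) - F (v s)‖ := by
    intro n t ht
    have ht' : t ∈ Set.Icc 0 T := ⟨ht.1.le, ht.2⟩
    have hd : ∀ t : ℝ, IntegrableOn (fun s => ‖F (u n s) - F (v s)‖) (Set.Ioc 0 t) := fun t =>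
      ((hFint _ (hmeas n) (hval n) t).sub (hFint v hvmeas hvval t)).norm
    unfold fixedPointMap
    rw [add_sub_add_left_eq_sub, intervalIntegral.integral_of_le ht.1.le,
      intervalIntegral.integral_of_le ht.1.le,
      ← integral_sub (hSint _ (hmeas n) (hval n) t ht') (hSint v hvmeas hvval t ht'),
      ← integral_const_mul]
    refine (norm_integral_le_of_norm_le
      (g := fun s => M * ‖F (u n s) - F (v s)‖) ((hd t).const_mul M) ?_).trans ?_
    · filter_upwards [ae_restrict_mem measurableSet_Ioc] with s hs
      rw [← map_sub]
      exact (S (t - s)).le_of_opNorm_le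
        (hM _ ⟨by linarith [hs.2], by linarith [hs.1, ht.2]⟩) _
    · exact setIntegral_mono_set ((hd T).const_mul M)
        (Eventually.of_forall fun s => mul_nonneg hM0 (norm_nonneg _))
        (Set.Ioc_subset_Ioc_right ht.2).eventuallyLE
  refine squeeze_zero_norm (a := fun n =>
    (M * ∫ s in Set.Ioc 0 T, ‖F (u n s) - F (v s)‖) * |T - 0|) (fun n => ?_) ?_
  · refine intervalIntegral.norm_integral_le_of_norm_le_const fun t ht => ?_
    rw [Set.uIoc_of_le hT.le] at ht
    rw [norm_norm]
    exact bound n t ht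
  · simpa using (key.const_mul M).mul_const |T - 0|
end
end

section
/- Let E be an ordered Banach space with normal positive cone E₊, let (S(t))_{t≥0} be a positive C₀-semigroup on E such that S(t) is a compact operator for every t > 0, let u̲ ≤ ū in E, let F : [u̲,ū] → E be continuous and increasing, fix u₀ ∈ [u̲,ū], and let G be the fixed-point map associated with u₀. Then G is compact in the following sense: for every sequence (uₙ) of strongly measurable functions from [0,∞) to E with values in [u̲,ū] a.e., there exist a subsequence (u_{n_k}) and a function v ∈ C([0,∞),E) such that ∫₀ᵀ ‖G(u_{n_k})(t) − v(t)‖ dt → 0 as k → ∞ for every T > 0. -/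
open MeasureTheory Filter Topology

noncomputable section

lemma aux_ascoli {E : Type*} [NormedAddCommGroup E] [CompleteSpace E] (g : ℕ → C(ℝ, E))
    (heq : ∀ t₀ : ℝ, ∀ ε > 0, ∃ δ > 0, ∀ t, |t - t₀| < δ → ∀ n, ‖g n t - g n t₀‖ < ε)
    (hK : ∀ t : ℝ, ∃ K : Set E, IsCompact K ∧ ∀ n, g n t ∈ K) :
    ∃ (φ : ℕ → ℕ) (v : C(ℝ, E)), StrictMono φ ∧ Tendsto (g ∘ φ) atTop (𝓝 v) := by
  have hc : IsCompact (closure (Set.range g)) := by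
    refine ArzelaAscoli.isCompact_closure_of_isClosedEmbedding
      (𝔖 := {K : Set ℝ | IsCompact K}) (F := fun f : C(ℝ, E) => (f : ℝ → E))
      (fun K h => h) ?_ ?_ ?_
    · haveI : T2Space (UniformOnFun ℝ E {K : Set ℝ | IsCompact K}) :=
        UniformOnFun.t2Space_of_covering
          (Set.eq_univ_iff_forall.2 fun x => Set.mem_sUnion_of_mem (Set.mem_singleton x)
            isCompact_singleton)
      exact ContinuousMap.isUniformEmbedding_toUniformOnFunIsCompact.isClosedEmbedding
    · intro K _
      refine Equicontinuous.equicontinuousOn ?_ K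
      intro t₀
      rw [Metric.equicontinuousAt_iff]
      intro ε hε
      obtain ⟨δ, hδ, h⟩ := heq t₀ ε hε
      refine ⟨δ, hδ, fun t ht i => ?_⟩
      obtain ⟨_, n, rfl⟩ := i
      rw [dist_comm, dist_eq_norm]
      exact h t (by simpa [Real.dist_eq] using ht) n
    · intro _ _ t _
      obtain ⟨K, h1, h2⟩ := hK t
      refine ⟨K, h1, ?_⟩
      rintro _ ⟨n, rfl⟩
      exact h2 n
  obtain ⟨v, _, φ, h1, h2⟩ := hc.isSeqCompact (x := g)
    (fun n => subset_closure (Set.mem_range_self n))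
  exact ⟨φ, v, h1, h2⟩

lemma aux_meas {E : Type*} [NormedAddCommGroup E] {μ : Measure ℝ} (K : Set E) (F : E → E)
    (hF : ContinuousOn F K) (u : ℝ → E) (x₀ : E) (hx₀ : x₀ ∈ K)
    (hu : AEStronglyMeasurable u μ) (huK : ∀ᵐ s ∂μ, u s ∈ K) :
    AEStronglyMeasurable (fun s => F (u s)) μ := by
  classical
  let w : ℝ → K := fun s => if h : u s ∈ K then ⟨u s, h⟩ else ⟨x₀, hx₀⟩
  have hw : (fun s => (w s : E)) =ᵐ[μ] u := by
    filter_upwards [huK] with s hs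
    simp [w, hs]
  have hwm : AEStronglyMeasurable w μ :=
    Topology.IsEmbedding.subtypeVal.aestronglyMeasurable_comp_iff.1 (hu.congr hw.symm)
  have hFr : Continuous (K.domRestrict F) := continuousOn_iff_continuous_domRestrict.1 hF
  refine (hFr.comp_aestronglyMeasurable hwm).congr ?_
  filter_upwards [hw] with s hs
  simp [Set.domRestrict, hs]

structure AuxSG {E : Type*} [NormedAddCommGroup E] [NormedSpace ℝ E]
    (R : ℝ → E →L[ℝ] E) : Prop where
  cont : Continuous (fun p : ℝ × E => R p.1 p.2)
  bd : ∀ T : ℝ, ∃ M : ℝ, 0 ≤ M ∧ ∀ r ≤ T, ‖R r‖ ≤ M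
  add : ∀ s t : ℝ, 0 ≤ s → 0 ≤ t → R (s + t) = (R s).comp (R t)
  zero : R 0 = 1
  cpt : ∀ t : ℝ, 0 < t → IsCompactOperator (⇑(R t))

lemma aux_sg {E : Type*} [NormedAddCommGroup E] [NormedSpace ℝ E] [CompleteSpace E]
    (S : ℝ → E →L[ℝ] E) (hS : IsC0Semigroup S)
    (hcpt : ∀ t : ℝ, 0 < t → IsCompactOperator (⇑(S t))) :
    AuxSG (fun r => S (max r 0)) := by
  obtain ⟨h0, hadd, hc⟩ := hS
  have hc' : ∀ x, Continuous (fun r : ℝ => S (max r 0) x) := by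
    intro x
    exact (hc x).comp_continuous (by fun_prop) (fun r => by simp)
  have hbd : ∀ T : ℝ, ∃ M : ℝ, 0 ≤ M ∧ ∀ r ≤ T, ‖S (max r 0)‖ ≤ M := by
    intro T
    obtain ⟨M, hM⟩ := banach_steinhaus (g := fun r : Set.Icc (0:ℝ) (max T 0) => S (max (r:ℝ) 0))
      (by
        intro x
        obtain ⟨C, hC⟩ := (isCompact_Icc (a := (0:ℝ)) (b := max T 0)).exists_bound_of_continuousOn
          (hc' x).continuousOn
        exact ⟨C, fun i => hC i i.2⟩)
    refine ⟨M, (norm_nonneg _).trans (hM ⟨0, by simp⟩), fun r hr => ?_⟩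
    have := hM ⟨max r 0, by simp, max_le_max_right _ hr⟩
    simpa using this
  refine ⟨?_, hbd, ?_, by simp [h0], ?_⟩
  · rw [continuous_iff_continuousAt]
    rintro ⟨r₀, x₀⟩
    obtain ⟨M, hM0, hM⟩ := hbd (r₀ + 1)
    rw [ContinuousAt, tendsto_iff_norm_sub_tendsto_zero]
    have hlim : Tendsto (fun p : ℝ × E => M * ‖p.2 - x₀‖ + ‖S (max p.1 0) x₀ - S (max r₀ 0) x₀‖)
        (𝓝 (r₀, x₀)) (𝓝 0) := by
      have : Continuous (fun p : ℝ × E => M * ‖p.2 - x₀‖ + ‖S (max p.1 0) x₀ - S (max r₀ 0) x₀‖) := by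
        have h1 : Continuous (fun p : ℝ × E => S (max p.1 0) x₀) :=
          (hc' x₀).comp (continuous_fst (X := ℝ) (Y := E))
        exact (continuous_const.mul (continuous_snd.sub continuous_const).norm).add
          (h1.sub continuous_const).norm
      simpa using this.tendsto (r₀, x₀)
    refine squeeze_zero' (Eventually.of_forall fun _ => norm_nonneg _) ?_ hlim
    have : ∀ᶠ p : ℝ × E in 𝓝 (r₀, x₀), p.1 < r₀ + 1 :=
      (continuous_fst (X := ℝ) (Y := E)).continuousAt.eventually_lt_const (by simp)
    filter_upwards [this] with p hp
    calc ‖S (max p.1 0) p.2 - S (max r₀ 0) x₀‖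
        = ‖S (max p.1 0) (p.2 - x₀) + (S (max p.1 0) x₀ - S (max r₀ 0) x₀)‖ := by
          rw [map_sub]; congr 1; abel
      _ ≤ _ := (norm_add_le _ _).trans (by
          gcongr
          exact (S (max p.1 0)).le_of_opNorm_le (hM _ hp.le) _)
  · intro s t hs ht
    simp only [max_eq_left hs, max_eq_left ht, max_eq_left (add_nonneg hs ht)]
    exact hadd s t hs ht
  · intro t ht
    simp only [max_eq_left ht.le]
    exact hcpt t ht

/-- the convolution -/
def auxConv {E : Type*} [NormedAddCommGroup E] [NormedSpace ℝ E]
    (R : ℝ → E →L[ℝ] E) (f : ℝ → E) (t : ℝ) : E := ∫ s in (0:ℝ)..t, R (t - s) (f s)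

section
variable {E : Type*} [NormedAddCommGroup E] [NormedSpace ℝ E] [CompleteSpace E]
  {R : ℝ → E →L[ℝ] E}

lemma aux_int (hR : AuxSG R) (f : ℝ → E) (hf : AEStronglyMeasurable f volume) (C : ℝ)
    (hC : ∀ᵐ s, ‖f s‖ ≤ C) (t a b : ℝ) :
    IntervalIntegrable (fun s => R (t - s) (f s)) volume a b := by
  obtain ⟨M, hM0, hM⟩ := hR.bd (t - min a b)
  have hm : AEStronglyMeasurable (fun s => R (t - s) (f s)) volume := by
    have : AEStronglyMeasurable (fun s : ℝ => (t - s, f s)) volume :=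
      AEStronglyMeasurable.prodMk (by fun_prop) hf
    exact hR.cont.comp_aestronglyMeasurable this
  refine (intervalIntegrable_const (c := M * C)).mono_fun hm.restrict ?_
  filter_upwards [ae_restrict_of_ae hC, ae_restrict_mem measurableSet_uIoc] with s hs hs'
  have h1 : min a b < s := hs'.1
  have := (R (t - s)).le_of_opNorm_le_of_le (hM _ (by linarith)) hs
  exact this.trans (le_abs_self _)

lemma aux_bd (hR : AuxSG R) (f : ℝ → E) (C M T : ℝ)
    (hC : ∀ᵐ s, ‖f s‖ ≤ C) (hM : ∀ r ≤ T, ‖R r‖ ≤ M) (t a b : ℝ) (hab : a ≤ b)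
    (h : t - a ≤ T) : ‖∫ s in a..b, R (t - s) (f s)‖ ≤ M * C * (b - a) := by
  have := intervalIntegral.norm_integral_le_of_norm_le_const_ae (a := a) (b := b) (C := M * C)
    (f := fun s => R (t - s) (f s)) (by
      filter_upwards [hC] with s hs hs'
      rw [Set.uIoc_of_le hab] at hs'
      exact (R (t - s)).le_of_opNorm_le_of_le (hM _ (by linarith [hs'.1])) hs)
  rwa [abs_of_nonneg (by linarith)] at this

lemma aux_split (hR : AuxSG R) (f : ℝ → E) (hf : AEStronglyMeasurable f volume) (C : ℝ)
    (hC : ∀ᵐ s, ‖f s‖ ≤ C) (t h : ℝ) (ht : 0 ≤ t) (hh : 0 ≤ h) :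
    auxConv R f (t + h) = R h (auxConv R f t) + ∫ s in t..(t + h), R (t + h - s) (f s) := by
  unfold auxConv
  rw [← intervalIntegral.integral_add_adjacent_intervals
    (aux_int hR f hf C hC (t + h) 0 t) (aux_int hR f hf C hC (t + h) t (t + h))]
  congr 1
  rw [← ContinuousLinearMap.intervalIntegral_comp_comm _ (aux_int hR f hf C hC t 0 t)]
  refine intervalIntegral.integral_congr fun s hs => ?_
  rw [Set.uIcc_of_le ht] at hs
  have : t + h - s = h + (t - s) := by ring
  simp only [this, hR.add h (t - s) hh (by linarith [hs.2])]
  rfl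

lemma aux_step (hR : AuxSG R) (f : ℝ → E) (hf : AEStronglyMeasurable f volume) (C M T : ℝ)
    (hC : ∀ᵐ s, ‖f s‖ ≤ C) (hM : ∀ r ≤ T, ‖R r‖ ≤ M) (t h : ℝ) (ht : 0 ≤ t) (hh : 0 ≤ h)
    (hT : h ≤ T) :
    ‖auxConv R f (t + h) - R h (auxConv R f t)‖ ≤ M * C * h := by
  rw [aux_split hR f hf C hC t h ht hh, add_sub_cancel_left]
  have := aux_bd hR f C M T hC hM (t + h) t (t + h) (by linarith) (by linarith)
  simpa using this

lemma aux_tb (hR : AuxSG R) (f : ℕ → ℝ → E) (hf : ∀ n, AEStronglyMeasurable (f n) volume) (C : ℝ)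
    (hC0 : 0 ≤ C) (hC : ∀ n, ∀ᵐ s, ‖f n s‖ ≤ C) (T : ℝ) :
    ∃ K : Set E, IsCompact K ∧ ∀ n, ∀ t, 0 ≤ t → t ≤ T → auxConv R (f n) t ∈ K := by
  obtain ⟨M, hM0, hM⟩ := hR.bd T
  let A : Set E := {x | ∃ n t, 0 ≤ t ∧ t ≤ T ∧ auxConv R (f n) t = x}
  have hA : TotallyBounded A := by
    rw [Metric.totallyBounded_iff]
    intro ε hε
    obtain ⟨h, hh0, hh⟩ : ∃ h : ℝ, 0 < h ∧ M * C * h < ε / 2 := by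
      have hMC : 0 ≤ M * C := by positivity
      refine ⟨ε / 2 / (M * C + 1), by positivity, ?_⟩
      rw [mul_div_assoc', div_lt_iff₀ (by positivity)]
      nlinarith
    have hbase : ∀ n t, 0 ≤ t → t ≤ T → ‖auxConv R (f n) t‖ ≤ M * C * t := by
      intro n t h0 h1
      have := aux_bd hR (f n) C M T (hC n) hM t 0 t h0 (by linarith)
      simpa [auxConv] using this
    obtain ⟨K, hK, hKs⟩ := IsCompactOperator.image_closedBall_subset_compact
      (f := (R h : E →ₗ[ℝ] E)) (hR.cpt h hh0) (M * C * T)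
    have hK' : TotallyBounded (insert 0 K) := (hK.insert 0).totallyBounded
    obtain ⟨s, hs, hsK⟩ := Metric.totallyBounded_iff.1 hK' (ε / 2) (by positivity)
    refine ⟨s, hs, ?_⟩
    rintro x ⟨n, t, h0, h1, rfl⟩
    have key : ∃ y ∈ insert 0 K, ‖auxConv R (f n) t - y‖ < ε / 2 := by
      rcases le_total t h with hth | hth
      · refine ⟨0, Set.mem_insert _ _, ?_⟩
        rw [sub_zero]
        refine ((hbase n t h0 h1).trans ?_).trans_lt hh
        gcongr
      · refine ⟨R h (auxConv R (f n) (t - h)), Set.mem_insert_of_mem _ (hKs ⟨_, ?_, rfl⟩), ?_⟩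
        · rw [mem_closedBall_zero_iff]
          refine (hbase n (t - h) (by linarith) (by linarith)).trans ?_
          gcongr
          linarith
        · have := aux_step hR (f n) (hf n) C M T (hC n) hM (t - h) h (by linarith) hh0.le
            (by linarith)
          rw [sub_add_cancel] at this
          exact this.trans_lt hh
    obtain ⟨y, hy, hy2⟩ := key
    have := hsK hy
    simp only [Set.mem_iUnion, Metric.mem_ball, exists_prop] at this ⊢
    obtain ⟨z, hz, hz2⟩ := this
    refine ⟨z, hz, ?_⟩
    rw [← dist_eq_norm] at hy2
    linarith [dist_triangle (auxConv R (f n) t) y z]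
  refine ⟨closure A, hA.closure.isCompact_of_isClosed isClosed_closure, fun n t h0 h1 => ?_⟩
  exact subset_closure ⟨n, t, h0, h1, rfl⟩

lemma aux_equi (hR : AuxSG R) (f : ℕ → ℝ → E) (hf : ∀ n, AEStronglyMeasurable (f n) volume) (C : ℝ)
    (hC0 : 0 ≤ C) (hC : ∀ n, ∀ᵐ s, ‖f n s‖ ≤ C) (T : ℝ) (ε : ℝ) (hε : 0 < ε) :
    ∃ δ > 0, ∀ a b, 0 ≤ a → a ≤ b → b ≤ T → b - a < δ → ∀ n,
      ‖auxConv R (f n) b - auxConv R (f n) a‖ < ε := by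
  obtain ⟨M, hM0, hM⟩ := hR.bd T
  obtain ⟨K, hK, hKm⟩ := aux_tb hR f hf C hC0 hC T
  have h1 : ∀ᶠ h in 𝓝 (0:ℝ), ∀ x ∈ K, ‖R h x - x‖ < ε / 2 := by
    refine hK.eventually_forall_of_forall_eventually (fun y _ => ?_)
    have hc : Continuous (fun p : ℝ × E => ‖R p.1 p.2 - p.2‖) :=
      (hR.cont.sub continuous_snd).norm
    refine hc.continuousAt.eventually_lt_const ?_
    simpa [hR.zero] using hε
  have h2 : ∀ᶠ h in 𝓝 (0:ℝ), M * C * h < ε / 2 := by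
    have hc : Continuous (fun h : ℝ => M * C * h) := by fun_prop
    refine hc.continuousAt.eventually_lt_const ?_
    simpa using hε
  obtain ⟨δ, hδ, h3⟩ := Metric.eventually_nhds_iff.1 (h1.and h2)
  refine ⟨δ, hδ, fun a b ha hab hb hd n => ?_⟩
  obtain ⟨h4, h5⟩ := h3 (y := b - a) (by simpa [abs_of_nonneg (sub_nonneg.2 hab)] using hd)
  have h6 := aux_step hR (f n) (hf n) C M T (hC n) hM a (b - a) ha (by linarith) (by linarith)
  rw [add_sub_cancel] at h6
  have h7 := h4 _ (hKm n a ha (by linarith))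
  calc _ = ‖(auxConv R (f n) b - R (b - a) (auxConv R (f n) a)) +
        (R (b - a) (auxConv R (f n) a) - auxConv R (f n) a)‖ := by congr 1; abel
    _ < ε := by
      refine (norm_add_le _ _).trans_lt ?_
      linarith

lemma aux_main (hR : AuxSG R) (f : ℕ → ℝ → E) (hf : ∀ n, AEStronglyMeasurable (f n) volume) (C : ℝ)
    (hC0 : 0 ≤ C) (hC : ∀ n, ∀ᵐ s, ‖f n s‖ ≤ C) :
    ∃ (φ : ℕ → ℕ) (v : ℝ → E), StrictMono φ ∧ Continuous v ∧
      ∀ T : ℝ, TendstoUniformlyOn (fun k t => auxConv R (f (φ k)) t) v atTop (Set.Icc 0 T) := by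
  have heq : ∀ t₀ : ℝ, ∀ ε > 0, ∃ δ > 0, ∀ t, |t - t₀| < δ → ∀ n,
      ‖auxConv R (f n) (max t 0) - auxConv R (f n) (max t₀ 0)‖ < ε := by
    intro t₀ ε hε
    obtain ⟨δ, hδ, h⟩ := aux_equi hR f hf C hC0 hC (max t₀ 0 + 1) ε hε
    refine ⟨min δ 1, by positivity, fun t ht n => ?_⟩
    have h1 : |max t 0 - max t₀ 0| < min δ 1 := (abs_max_sub_max_le_abs t t₀ 0).trans_lt ht
    obtain ⟨h1, h2⟩ := lt_min_iff.1 h1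
    rw [abs_lt] at h1 h2
    rcases le_total (max t 0) (max t₀ 0) with h3 | h3
    · rw [norm_sub_rev]
      exact h _ _ (le_max_right _ _) h3 (by linarith) (by linarith) n
    · exact h _ _ (le_max_right _ _) h3 (by linarith) (by linarith) n
  let g : ℕ → C(ℝ, E) := fun n => ⟨fun t => auxConv R (f n) (max t 0), by
    rw [Metric.continuous_iff]
    intro t₀ ε hε
    obtain ⟨δ, hδ, h⟩ := heq t₀ ε hε
    refine ⟨δ, hδ, fun t ht => ?_⟩
    rw [dist_eq_norm]
    exact h t (by simpa [Real.dist_eq] using ht) n⟩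
  obtain ⟨φ, v, hφ, hv⟩ := aux_ascoli g heq (fun t => by
    obtain ⟨K, hK, hKm⟩ := aux_tb hR f hf C hC0 hC (max t 0)
    exact ⟨K, hK, fun n => hKm n _ (le_max_right _ _) le_rfl⟩)
  refine ⟨φ, v, hφ, v.continuous, fun T => ?_⟩
  have := ContinuousMap.tendsto_iff_forall_isCompact_tendstoUniformlyOn.1 hv (Set.Icc 0 T)
    isCompact_Icc
  refine this.congr (Eventually.of_forall fun k t ht => ?_)
  simp [g, max_eq_left ht.1]

end

/-- if `S(t)` is a compact operator for each `t > 0`, then the fixed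
point map `G` is compact: every sequence of interval-valued functions has a
subsequence whose `G`-images converge locally in `L¹` to a continuous function. -/
theorem fixedPointMap_compact
    {E : Type*} [NormedAddCommGroup E] [NormedSpace ℝ E] [CompleteSpace E]
    (P : Set E) (S : ℝ → E →L[ℝ] E) (F : E → E) (ua ub u0 : E)
    (hP : IsProperCone P) (hN : IsNormalCone P) (hS : IsPositiveSemigroup P S)
    (hcpt : ∀ t : ℝ, 0 < t → IsCompactOperator (⇑(S t)))
    (hab : coneLE P ua ub)
    (hFc : ContinuousOn F (orderInterval P ua ub))
    (hFm : ∀ x ∈ orderInterval P ua ub, ∀ y ∈ orderInterval P ua ub,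
      coneLE P x y → coneLE P (F x) (F y))
    (hu0 : u0 ∈ orderInterval P ua ub) :
    ∀ u : ℕ → ℝ → E,
      (∀ n, AEStronglyMeasurable (u n) (volume.restrict (Set.Ici (0:ℝ)))) →
      (∀ n, ∀ᵐ s ∂volume.restrict (Set.Ici (0:ℝ)), u n s ∈ orderInterval P ua ub) →
      ∃ (φ : ℕ → ℕ) (v : ℝ → E), StrictMono φ ∧ ContinuousOn v (Set.Ici 0) ∧
        ∀ T : ℝ, 0 < T →
          Filter.Tendsto
            (fun k => ∫ t in (0:ℝ)..T, ‖fixedPointMap S F u0 (u (φ k)) t - v t‖)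
            Filter.atTop (nhds 0) := by
  intro u hum huI
  obtain ⟨C, hCn⟩ := hN (F ua) (F ub)
  have hP0 : (0:E) ∈ P := by
    have := hP.2.2.1 0 le_rfl _ hab
    simpa using this
  have huaI : ua ∈ orderInterval P ua ub := ⟨by simpa [coneLE] using hP0, hab⟩
  have hubI : ub ∈ orderInterval P ua ub := ⟨hab, by simpa [coneLE] using hP0⟩
  have hFb : ∀ x ∈ orderInterval P ua ub, ‖F x‖ ≤ C := fun x hx =>
    hCn _ ⟨hFm _ huaI _ hx hx.1, hFm _ hx _ hubI hx.2⟩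
  have hC0 : 0 ≤ C := (norm_nonneg _).trans (hFb _ huaI)
  have hR := aux_sg S hS.1 hcpt
  let f : ℕ → ℝ → E := fun n => (Set.Ici (0:ℝ)).indicator (fun s => F (u n s))
  have hf : ∀ n, AEStronglyMeasurable (f n) volume := fun n =>
    (aestronglyMeasurable_indicator_iff measurableSet_Ici).2
      (aux_meas _ F hFc (u n) ua huaI (hum n) (huI n))
  have hfb : ∀ n, ∀ᵐ s, ‖f n s‖ ≤ C := by
    intro n
    have := (ae_restrict_iff' measurableSet_Ici).1 (huI n)
    filter_upwards [this] with s hs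
    by_cases h : s ∈ Set.Ici (0:ℝ)
    · simpa [f, Set.indicator_of_mem h] using hFb _ (hs h)
    · simpa [f, Set.indicator_of_notMem h] using hC0
  obtain ⟨φ, v, hφ, hv, hlim⟩ := aux_main hR f hf C hC0 hfb
  refine ⟨φ, fun t => S t u0 + v t, hφ, (hS.1.2.2 u0).add hv.continuousOn, fun T hT => ?_⟩
  have hG : ∀ n t, 0 ≤ t → fixedPointMap S F u0 (u n) t
      = S t u0 + auxConv (fun r => S (max r 0)) (f n) t := by
    intro n t ht
    unfold fixedPointMap auxConv
    congr 1
    refine intervalIntegral.integral_congr fun s hs => ?_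
    rw [Set.uIcc_of_le ht] at hs
    have h1 : s ∈ Set.Ici (0:ℝ) := hs.1
    simp only [f, Set.indicator_of_mem h1, max_eq_left (sub_nonneg.2 hs.2)]
  rw [Metric.tendsto_nhds]
  intro ε hε
  have hU := Metric.tendstoUniformlyOn_iff.1 (hlim T) (ε / (2 * T)) (by positivity)
  filter_upwards [hU] with k hk
  have h2 := intervalIntegral.norm_integral_le_of_norm_le_const (a := 0) (b := T)
    (C := ε / (2 * T)) (f := fun t => ‖fixedPointMap S F u0 (u (φ k)) t - (S t u0 + v t)‖) (by
      intro t ht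
      rw [Set.uIoc_of_le hT.le] at ht
      have := hk t ⟨ht.1.le, ht.2⟩
      rw [dist_comm, dist_eq_norm] at this
      rw [hG _ _ ht.1.le, add_sub_add_left_eq_sub, norm_norm]
      exact this.le)
  rw [dist_zero_right]
  refine h2.trans_lt ?_
  rw [sub_zero, abs_of_pos hT]
  have : ε / (2 * T) * T = ε / 2 := by field_simp
  linarith
end
end

section
/- Let E be an ordered Banach space with normal positive cone E₊, let (S(t))_{t≥0} be a positive C₀-semigroup on E, let u̲ ≤ ū in E, let F : [u̲,ū] → E be continuous and increasing, and assume hypothesis (H): for all t ≥ 0, u̲ ≤ S(t)u̲ + ∫₀ᵗ S(s)F(u̲) ds and S(t)ū + ∫₀ᵗ S(s)F(ū) ds ≤ ū. Fix u₀ ∈ [u̲,ū], let G be the fixed-point map associated with u₀, and define iteratively w̲₀ ≡ u̲, w̲_{n+1} := G(w̲ₙ) and w̄₀ ≡ ū, w̄_{n+1} := G(w̄ₙ) (constant functions being identified with functions on [0,∞)). Then for all n, m ≥ 1 and all t ≥ 0: u̲ ≤ w̲ₙ(t) ≤ w̲_{n+1}(t) ≤ w̄_{m+1}(t) ≤ w̄ₘ(t)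 ≤ ū. -/
open MeasureTheory Filter Topology

noncomputable section

section helpers

variable {E : Type*} [NormedAddCommGroup E] [NormedSpace ℝ E]

theorem aux_joint [CompleteSpace E] (S : ℝ → E →L[ℝ] E)
    (hS : ∀ x : E, ContinuousOn (fun t => S t x) (Set.Ici 0)) :
    Continuous (fun p : ℝ × E => S (max p.1 0) p.2) := by
  have hc : ∀ x : E, Continuous (fun t : ℝ => S (max t 0) x) := fun x =>
    (hS x).comp_continuous (by fun_prop) (fun t => Set.mem_Ici.2 (le_max_right _ _))
  rw [continuous_iff_continuousAt]
  rintro ⟨t0, x0⟩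
  obtain ⟨C, hC⟩ : ∃ C, ∀ i : Set.Icc (t0 - 1) (t0 + 1), ‖S (max i.1 0)‖ ≤ C := by
    apply banach_steinhaus
    intro x
    obtain ⟨C, hC⟩ := (isCompact_Icc (a := t0 - 1) (b := t0 + 1)).exists_bound_of_continuousOn
      (hc x).continuousOn
    exact ⟨C, fun i => hC i.1 i.2⟩
  unfold ContinuousAt
  rw [tendsto_iff_norm_sub_tendsto_zero]
  have hlim : Tendsto (fun p : ℝ × E => C * ‖p.2 - x0‖ + ‖S (max p.1 0) x0 - S (max t0 0) x0‖)
      (𝓝 (t0, x0)) (𝓝 0) := by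
    have h1 : Continuous (fun p : ℝ × E => C * ‖p.2 - x0‖ +
        ‖S (max p.1 0) x0 - S (max t0 0) x0‖) := by
      have := (hc x0).comp (continuous_fst (X := ℝ) (Y := E))
      simp only [Function.comp_def] at this
      exact (continuous_const.mul (continuous_snd.sub continuous_const).norm).add
        (this.sub continuous_const).norm
    have := h1.tendsto (t0, x0)
    simpa using this
  refine squeeze_zero' (Eventually.of_forall fun _ => norm_nonneg _) ?_ hlim
  have hev : ∀ᶠ p : ℝ × E in 𝓝 (t0, x0), p.1 ∈ Set.Icc (t0 - 1) (t0 + 1) :=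
    (continuous_fst.tendsto (t0, x0)).eventually
      (Icc_mem_nhds (by simp) (by simp))
  filter_upwards [hev] with p hp
  have e : S (max p.1 0) p.2 - S (max t0 0) x0 =
      S (max p.1 0) (p.2 - x0) + (S (max p.1 0) x0 - S (max t0 0) x0) := by
    rw [map_sub]; abel
  rw [e]
  refine (norm_add_le _ _).trans ?_
  gcongr
  exact (S (max p.1 0)).le_of_opNorm_le (hC ⟨p.1, hp⟩) _

theorem aux_integral_mem [CompleteSpace E] {P : Set E} (hP : IsProperCone P) (h0 : (0 : E) ∈ P)
    {f : ℝ → E} (hf : Continuous f) {t : ℝ} (ht : 0 ≤ t)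
    (hfP : ∀ s, 0 ≤ s → s ≤ t → f s ∈ P) : (∫ s in (0:ℝ)..t, f s) ∈ P := by
  obtain ⟨hcl, hadd, hsm, -⟩ := hP
  rcases ht.eq_or_lt with rfl | ht'
  · simpa using h0
  have hconv : Convex ℝ P := by
    intro x hx y hy a b ha hb _
    exact hadd _ (hsm a ha x hx) _ (hsm b hb y hy)
  have hav := hconv.set_average_mem (μ := volume) (t := Set.Ioc 0 t) (f := f) hcl
    (by simp [ht']) (by simp)
    (by
      filter_upwards [ae_restrict_mem measurableSet_Ioc] with s hs
      exact hfP s hs.1.le hs.2)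
    (hf.integrableOn_Ioc)
  rw [setAverage_eq] at hav
  have := hsm t ht _ hav
  rw [intervalIntegral.integral_of_le ht]
  simpa [smul_smul, Measure.real, ht, ht'.ne'] using this

/-- the regularized integrand -/
theorem aux_integrand [CompleteSpace E] {S : ℝ → E →L[ℝ] E}
    (hS : ∀ x : E, ContinuousOn (fun t => S t x) (Set.Ici 0))
    {g : ℝ → E} (hg : ContinuousOn g (Set.Ici 0)) :
    Continuous (fun p : ℝ × ℝ => S (max (p.1 - p.2) 0) (g (max p.2 0))) := by
  have hg' : Continuous (fun s : ℝ => g (max s 0)) :=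
    hg.comp_continuous (by fun_prop) (fun t => Set.mem_Ici.2 (le_max_right _ _))
  have hg2 : Continuous (fun p : ℝ × ℝ => g (max p.2 0)) := hg'.comp continuous_snd
  exact (aux_joint S hS).comp
    (f := fun p : ℝ × ℝ => (p.1 - p.2, g (max p.2 0)))
    (Continuous.prodMk (by fun_prop) hg2)

theorem aux_integral_eq (S : ℝ → E →L[ℝ] E) (g : ℝ → E) {t : ℝ} (ht : 0 ≤ t) :
    (∫ s in (0:ℝ)..t, S (t - s) (g s)) =
      ∫ s in (0:ℝ)..t, S (max (t - s) 0) (g (max s 0)) := by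
  apply intervalIntegral.integral_congr
  intro s hs
  rw [Set.uIcc_of_le ht] at hs
  have h1 : max (t - s) 0 = t - s := max_eq_left (by linarith [hs.2])
  have h2 : max s 0 = s := max_eq_left hs.1
  simp only [h1, h2]

theorem aux_cont [CompleteSpace E] {S : ℝ → E →L[ℝ] E}
    (hS : ∀ x : E, ContinuousOn (fun t => S t x) (Set.Ici 0)) (F : E → E) (u0 : E)
    {u : ℝ → E} (hg : ContinuousOn (fun s => F (u s)) (Set.Ici 0)) :
    ContinuousOn (fixedPointMap S F u0 u) (Set.Ici 0) := by
  have h1 : Continuous (fun t : ℝ => ∫ s in (0:ℝ)..t,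
      S (max (t - s) 0) ((fun s => F (u s)) (max s 0))) :=
    intervalIntegral.continuous_parametric_intervalIntegral_of_continuous
      (aux_integrand hS hg) continuous_id
  refine ((hS u0).add h1.continuousOn).congr ?_
  intro t ht
  simp only [fixedPointMap]
  rw [aux_integral_eq S (fun s => F (u s)) ht]
  rfl

theorem aux_mono [CompleteSpace E] {P : Set E} (hP : IsProperCone P) (h0 : (0 : E) ∈ P)
    {S : ℝ → E →L[ℝ] E} (hS : IsPositiveSemigroup P S) (F : E → E) {u0 v0 : E}
    {u v : ℝ → E} (hu : ContinuousOn (fun s => F (u s)) (Set.Ici 0))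
    (hv : ContinuousOn (fun s => F (v s)) (Set.Ici 0)) (h : coneLE P u0 v0)
    (huv : ∀ s, 0 ≤ s → coneLE P (F (u s)) (F (v s))) {t : ℝ} (ht : 0 ≤ t) :
    coneLE P (fixedPointMap S F u0 u t) (fixedPointMap S F v0 v t) := by
  have hSc := hS.1.2.2
  have cu := (aux_integrand hSc hu).comp (Continuous.prodMk_right t)
  have cv := (aux_integrand hSc hv).comp (Continuous.prodMk_right t)
  simp only [Function.comp_def] at cu cv
  have key := aux_integral_mem hP h0 (cv.sub cu) ht (by
    intro s hs hst
    rw [Pi.sub_apply, ← map_sub]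
    exact hS.2 _ (le_max_right _ _) _ (huv _ (le_max_right _ _)))
  simp only [Pi.sub_apply] at key
  rw [intervalIntegral.integral_sub (cv.intervalIntegrable _ _) (cu.intervalIntegrable _ _)] at key
  have k2 := hS.2 t ht _ h
  have k3 := hP.2.1 _ k2 _ key
  unfold coneLE fixedPointMap
  rw [aux_integral_eq S (fun s => F (u s)) ht, aux_integral_eq S (fun s => F (v s)) ht]
  convert k3 using 1
  rw [map_sub]; abel

theorem aux_trans {P : Set E} (hP : IsProperCone P) {x y z : E} (h1 : coneLE P x y)
    (h2 : coneLE P y z) : coneLE P x z := by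
  have := hP.2.1 _ h1 _ h2
  unfold coneLE
  convert this using 1
  abel

theorem aux_const (S : ℝ → E →L[ℝ] E) (F : E → E) (a : E) (t : ℝ) :
    fixedPointMap S F a (fun _ => a) t = S t a + ∫ s in (0:ℝ)..t, S s (F a) := by
  unfold fixedPointMap
  rw [intervalIntegral.integral_comp_sub_left (fun s => S s (F a)) t]
  simp

end helpers

/-- the lower and upper iteration sequences are ordered monotonically
between the sub-solution and the super-solution. -/
theorem monotone_iterations
    {E : Type*} [NormedAddCommGroup E] [NormedSpace ℝ E] [CompleteSpace E]
    (P : Set E) (S : ℝ → E →L[ℝ] E) (F : E → E) (ua ub u0 : E)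
    (hP : IsProperCone P) (hN : IsNormalCone P) (hS : IsPositiveSemigroup P S)
    (hab : coneLE P ua ub)
    (hFc : ContinuousOn F (orderInterval P ua ub))
    (hFm : ∀ x ∈ orderInterval P ua ub, ∀ y ∈ orderInterval P ua ub,
      coneLE P x y → coneLE P (F x) (F y))
    (hH : ∀ t : ℝ, 0 ≤ t →
      coneLE P ua (S t ua + ∫ s in (0:ℝ)..t, S s (F ua)) ∧
      coneLE P (S t ub + ∫ s in (0:ℝ)..t, S s (F ub)) ub)
    (hu0 : u0 ∈ orderInterval P ua ub)
    (w W : ℕ → ℝ → E)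
    (hw0 : w 0 = fun _ => ua)
    (hwsucc : ∀ n, w (n + 1) = fixedPointMap S F u0 (w n))
    (hW0 : W 0 = fun _ => ub)
    (hWsucc : ∀ n, W (n + 1) = fixedPointMap S F u0 (W n)) :
    ∀ n m : ℕ, 1 ≤ n → 1 ≤ m → ∀ t : ℝ, 0 ≤ t →
      coneLE P ua (w n t) ∧ coneLE P (w n t) (w (n + 1) t) ∧
      coneLE P (w (n + 1) t) (W (m + 1) t) ∧ coneLE P (W (m + 1) t) (W m t) ∧
      coneLE P (W m t) ub := by
  have h0 : (0 : E) ∈ P := by simpa using hP.2.2.1 0 le_rfl _ hab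
  have hSc := hS.1.2.2
  have hrefl : ∀ x, coneLE P x x := fun x => by simpa [coneLE] using h0
  have hGc : ∀ u : ℝ → E, ContinuousOn u (Set.Ici 0) →
      (∀ t, 0 ≤ t → u t ∈ orderInterval P ua ub) →
      ContinuousOn (fun s => F (u s)) (Set.Ici 0) := fun u hu hI =>
    hFc.comp hu (fun t ht => hI t ht)
  have haI : ua ∈ orderInterval P ua ub := ⟨hrefl _, hab⟩
  have hbI : ub ∈ orderInterval P ua ub := ⟨hab, hrefl _⟩
  have good : ∀ u : ℝ → E, ContinuousOn u (Set.Ici 0) →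
      (∀ t, 0 ≤ t → u t ∈ orderInterval P ua ub) →
      ContinuousOn (fixedPointMap S F u0 u) (Set.Ici 0) ∧
      (∀ t, 0 ≤ t → fixedPointMap S F u0 u t ∈ orderInterval P ua ub) := by
    intro u hu hI
    refine ⟨aux_cont hSc F u0 (hGc u hu hI), fun t ht => ⟨?_, ?_⟩⟩
    · have h1 := (hH t ht).1
      rw [← aux_const] at h1
      exact aux_trans hP h1 (aux_mono hP h0 hS F continuousOn_const (hGc u hu hI) hu0.1
        (fun s hs => hFm _ haI _ (hI s hs) (hI s hs).1) ht)
    · have h1 := (hH t ht).2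
      rw [← aux_const] at h1
      exact aux_trans hP (aux_mono hP h0 hS F (hGc u hu hI) continuousOn_const hu0.2
        (fun s hs => hFm _ (hI s hs) _ hbI (hI s hs).2) ht) h1
  have gw : ∀ n, ContinuousOn (w n) (Set.Ici 0) ∧
      ∀ t, 0 ≤ t → w n t ∈ orderInterval P ua ub := by
    intro n
    induction n with
    | zero => rw [hw0]; exact ⟨continuousOn_const, fun _ _ => haI⟩
    | succ n ih => rw [hwsucc]; exact good _ ih.1 ih.2
  have gW : ∀ n, ContinuousOn (W n) (Set.Ici 0) ∧
      ∀ t, 0 ≤ t → W n t ∈ orderInterval P ua ub := by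
    intro n
    induction n with
    | zero => rw [hW0]; exact ⟨continuousOn_const, fun _ _ => hbI⟩
    | succ n ih => rw [hWsucc]; exact good _ ih.1 ih.2
  have mono : ∀ u v : ℝ → E, (ContinuousOn u (Set.Ici 0) ∧
      ∀ t, 0 ≤ t → u t ∈ orderInterval P ua ub) → (ContinuousOn v (Set.Ici 0) ∧
      ∀ t, 0 ≤ t → v t ∈ orderInterval P ua ub) → (∀ t, 0 ≤ t → coneLE P (u t) (v t)) →
      ∀ t, 0 ≤ t → coneLE P (fixedPointMap S F u0 u t) (fixedPointMap S F u0 v t) := by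
    intro u v hu hv huv t ht
    exact aux_mono hP h0 hS F (hGc u hu.1 hu.2) (hGc v hv.1 hv.2) (hrefl _)
      (fun s hs => hFm _ (hu.2 s hs) _ (hv.2 s hs) (huv s hs)) ht
  have mw : ∀ n, ∀ t, 0 ≤ t → coneLE P (w n t) (w (n + 1) t) := by
    intro n
    induction n with
    | zero => intro t ht; rw [hw0]; exact ((gw 1).2 t ht).1
    | succ n ih =>
      rw [hwsucc (n + 1)]
      nth_rewrite 1 [hwsucc n]
      exact mono _ _ (gw n) (gw (n + 1)) ih
  have mW : ∀ n, ∀ t, 0 ≤ t → coneLE P (W (n + 1) t) (W n t) := by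
    intro n
    induction n with
    | zero => intro t ht; rw [hW0]; exact ((gW 1).2 t ht).2
    | succ n ih =>
      rw [hWsucc (n + 1)]
      nth_rewrite 2 [hWsucc n]
      exact mono _ _ (gW (n + 1)) (gW n) ih
  have mwW : ∀ n m, ∀ t, 0 ≤ t → coneLE P (w n t) (W m t) := by
    intro n
    induction n with
    | zero => intro m t ht; rw [hw0]; exact ((gW m).2 t ht).1
    | succ n ih =>
      intro m
      cases m with
      | zero => intro t ht; rw [hW0]; exact ((gw (n + 1)).2 t ht).2
      | succ m =>
        rw [hwsucc n, hWsucc m]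
        exact mono _ _ (gw n) (gW m) (ih m)
  intro n m _ _ t ht
  exact ⟨((gw n).2 t ht).1, mw n t ht, mwW _ _ t ht, mW m t ht, ((gW m).2 t ht).2⟩
end
end

section
/- Let E be an ordered Banach space with normal positive cone E₊ and with order continuous norm, and let u̲ ≤ ū in E. Let (uₙ) be a sequence of strongly measurable functions from [0,∞) to E such that u̲ ≤ uₙ(t) ≤ u_{n+1}(t) ≤ ū for a.e. t ≥ 0 and every n. Then there exists a strongly measurable u : [0,∞) → E with values in [u̲,ū] a.e. such that ∫₀ᵀ ‖uₙ(t) − u(t)‖ dt → 0 for every T > 0. -/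
open MeasureTheory Filter Topology

noncomputable section

/-- if `E` has order continuous norm, every a.e. increasing sequence of
strongly measurable functions with values in an order interval converges locally in
`L¹` to a strongly measurable interval-valued function. -/
theorem monotone_L1loc_convergence_of_orderContinuousNorm
    {E : Type*} [NormedAddCommGroup E] [NormedSpace ℝ E] [CompleteSpace E]
    (P : Set E) (hP : IsProperCone P) (hN : IsNormalCone P)
    (hocn : OrderContinuousNorm P)
    (ua ub : E) (hab : coneLE P ua ub)
    (u : ℕ → ℝ → E)
    (hmeas : ∀ n, AEStronglyMeasurable (u n) (volume.restrict (Set.Ici (0:ℝ))))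
    (hval : ∀ n, ∀ᵐ t ∂volume.restrict (Set.Ici (0:ℝ)),
      u n t ∈ orderInterval P ua ub ∧ coneLE P (u n t) (u (n + 1) t)) :
    ∃ v : ℝ → E,
      AEStronglyMeasurable v (volume.restrict (Set.Ici (0:ℝ))) ∧
      (∀ᵐ t ∂volume.restrict (Set.Ici (0:ℝ)), v t ∈ orderInterval P ua ub) ∧
      ∀ T : ℝ, 0 < T →
        Filter.Tendsto (fun n => ∫ t in (0:ℝ)..T, ‖u n t - v t‖) Filter.atTop (nhds 0) := by
  obtain ⟨hcl, -, -, -⟩ := hP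
  have hall := ae_all_iff.2 hval
  have hlim : ∀ᵐ t ∂volume.restrict (Set.Ici (0:ℝ)),
      ∃ l : E, Tendsto (fun n => u n t) atTop (𝓝 l) := by
    filter_upwards [hall] with t ht
    exact hocn (fun n => u n t) ua ub (fun n => (ht n).2) (fun n => (ht n).1)
  obtain ⟨v, hv, hvt⟩ := exists_stronglyMeasurable_limit_of_tendsto_ae hmeas hlim
  have hvi : ∀ᵐ t ∂volume.restrict (Set.Ici (0:ℝ)), v t ∈ orderInterval P ua ub := by
    filter_upwards [hall, hvt] with t ht hvt
    exact ⟨hcl.mem_of_tendsto (hvt.sub_const ua) (Eventually.of_forall fun n => (ht n).1.1),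
      hcl.mem_of_tendsto (hvt.const_sub ub) (Eventually.of_forall fun n => (ht n).1.2)⟩
  refine ⟨v, hv.aestronglyMeasurable, hvi, fun T hT => ?_⟩
  obtain ⟨C, hC⟩ := hN ua ub
  have hsub : Set.Ioc 0 T ⊆ Set.Ici (0:ℝ) := fun t ht => ht.1.le
  have hle : volume.restrict (Set.Ioc 0 T) ≤ volume.restrict (Set.Ici (0:ℝ)) :=
    Measure.restrict_mono hsub le_rfl
  simp only [intervalIntegral.integral_of_le hT.le]
  have key := tendsto_integral_of_dominated_convergence (μ := volume.restrict (Set.Ioc 0 T))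
    (F := fun n t => ‖u n t - v t‖) (f := fun _ => (0:ℝ)) (fun _ => C + C)
    (fun n => (((hmeas n).mono_measure hle).sub hv.aestronglyMeasurable).norm)
    (integrable_const _)
    (fun n => by
      filter_upwards [ae_mono hle (hval n), ae_mono hle hvi] with t h1 h2
      rw [norm_norm]
      exact (norm_sub_le _ _).trans (add_le_add (hC _ h1.1) (hC _ h2)))
    (by
      filter_upwards [ae_mono hle hvt] with t h
      exact tendsto_iff_norm_sub_tendsto_zero.1 h)
  simpa using key
end
end

section
/- Let E be a Banach space, (S(t))_{t≥0} a C₀-semigroup on E, F : K → E a continuous map defined on a subset K ⊆ E, μ ∈ ℝ, and u₀ ∈ K. For u ∈ C([0,∞),E) taking values in K, the following are equivalent: (i) u(t) = S(t)u₀ + ∫₀ᵗ S(t−s)F(u(s)) ds for all t ≥ 0; (ii) u(t) = e^{−μt}S(t)u₀ + ∫₀ᵗ e^{−μ(t−s)}S(t−s)(F(u(s)) + μu(s)) ds for all t ≥ 0. (The family (e^{−μt}S(t))_{t≥0} is the C₀-semigroup generated by −(A+μ) when −A generates (S(t))_{t≥0}.) -/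
open MeasureTheory Filter Topology

noncomputable section

theorem c0_conv_cont {E : Type*} [NormedAddCommGroup E] [NormedSpace ℝ E] [CompleteSpace E]
    (T : ℝ → E →L[ℝ] E) (hT : ∀ x : E, ContinuousOn (fun t => T t x) (Set.Ici 0))
    (f : ℝ → E) (hf : ContinuousOn f (Set.Ici 0)) (t : ℝ) :
    ContinuousOn (fun s => T (t - s) (f s)) (Set.Icc 0 t) := by
  obtain ⟨C, hC⟩ : ∃ C, ∀ i : Set.Icc (0:ℝ) t, ‖T i‖ ≤ C := by
    apply banach_steinhaus
    intro x
    obtain ⟨C, hC⟩ := isCompact_Icc.exists_bound_of_continuousOn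
      ((hT x).mono (Set.Icc_subset_Ici_self : Set.Icc (0:ℝ) t ⊆ _))
    exact ⟨C, fun i => hC i i.2⟩
  intro s hs
  have h1 : Tendsto (fun r => T (t - r) (f s)) (𝓝[Set.Icc 0 t] s) (𝓝 (T (t - s) (f s))) := by
    have h2 : ContinuousOn (fun r => T (t - r) (f s)) (Set.Icc 0 t) :=
      (hT (f s)).comp (by fun_prop : ContinuousOn (fun r : ℝ => t - r) (Set.Icc 0 t))
        (fun r hr => by simpa using hr.2)
    exact h2 s hs
  have h3 : Tendsto (fun r => T (t - r) (f r - f s)) (𝓝[Set.Icc 0 t] s) (𝓝 0) := by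
    have h4 : Tendsto (fun r => C * ‖f r - f s‖) (𝓝[Set.Icc 0 t] s) (𝓝 0) := by
      have h5 : Tendsto f (𝓝[Set.Icc 0 t] s) (𝓝 (f s)) :=
        (hf.mono Set.Icc_subset_Ici_self) s hs
      have h6 := ((h5.sub_const (f s)).norm).const_mul C
      simpa using h6
    refine squeeze_zero_norm' ?_ h4
    filter_upwards [self_mem_nhdsWithin] with r hr
    exact (T (t - r)).le_of_opNorm_le
      (hC ⟨t - r, by linarith [hr.2], by linarith [hr.1]⟩) _
  have h7 := h1.add h3
  simp only [map_sub, add_sub_cancel, add_zero] at h7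
  exact h7

theorem mild_aux {E : Type*} [NormedAddCommGroup E] [NormedSpace ℝ E] [CompleteSpace E]
    (T : ℝ → E →L[ℝ] E) (hS : IsC0Semigroup T)
    (f : ℝ → E) (hf : ContinuousOn f (Set.Ici 0)) (ν : ℝ) (u0 : E)
    (u : ℝ → E) (hu : ContinuousOn u (Set.Ici 0))
    (h : ∀ t : ℝ, 0 ≤ t → u t = T t u0 + ∫ s in (0:ℝ)..t, T (t - s) (f s))
    (t : ℝ) (ht : 0 ≤ t) : u t = Real.exp (-ν * t) • T t u0 +
      ∫ s in (0:ℝ)..t, Real.exp (-ν * (t - s)) • T (t - s) (f s + ν • u s) := by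
  obtain ⟨h0, hadd, hT⟩ := hS
  have hg := c0_conv_cont T hT f hf t
  have hgu := c0_conv_cont T hT (fun s => f s + ν • u s) (hf.add (hu.const_smul ν)) t
  obtain ⟨g, hgc, hgeq⟩ : ∃ g : ℝ → E, Continuous g ∧
      ∀ s ∈ Set.Icc 0 t, g s = T (t - s) (f s) :=
    ⟨Set.IccExtend ht ((Set.Icc 0 t).domRestrict fun s => T (t - s) (f s)),
      (continuousOn_iff_continuous_domRestrict.1 hg).Icc_extend',
      fun s hs => by rw [Set.IccExtend_of_mem _ _ hs]; rfl⟩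
  have key : ∀ s ∈ Set.Icc 0 t, T (t - s) (u s) = T t u0 + ∫ r in (0:ℝ)..s, g r := by
    intro s hs
    have e1 : T t = (T (t - s)).comp (T s) := by
      rw [← hadd (t - s) s (by linarith [hs.2]) hs.1, sub_add_cancel]
    have hint : IntervalIntegrable (fun r => T (s - r) (f r)) volume 0 s :=
      ContinuousOn.intervalIntegrable_of_Icc hs.1 (c0_conv_cont T hT f hf s)
    rw [h s hs.1, map_add, e1, ContinuousLinearMap.comp_apply,
      ← ContinuousLinearMap.intervalIntegral_comp_comm _ hint]
    congr 1
    apply intervalIntegral.integral_congr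
    intro r hr
    rw [Set.uIcc_of_le hs.1] at hr
    show T (t - s) (T (s - r) (f r)) = g r
    rw [hgeq r ⟨hr.1, hr.2.trans hs.2⟩, ← ContinuousLinearMap.comp_apply,
      ← hadd (t - s) (s - r) (by linarith [hs.2]) (by linarith [hr.2])]
    congr 2
    ring
  have hd : ∀ s : ℝ, HasDerivAt
      (fun s => Real.exp (-ν * (t - s)) • (T t u0 + ∫ r in (0:ℝ)..s, g r))
      (Real.exp (-ν * (t - s)) • g s +
        (Real.exp (-ν * (t - s)) * ν) • (T t u0 + ∫ r in (0:ℝ)..s, g r)) s := by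
    intro s
    have a1 : HasDerivAt (fun s => Real.exp (-ν * (t - s))) (Real.exp (-ν * (t - s)) * ν) s := by
      have := (((hasDerivAt_id s).const_sub t).const_mul (-ν)).exp
      simpa using this
    have a2 : HasDerivAt (fun s => T t u0 + ∫ r in (0:ℝ)..s, g r) (g s) s :=
      (hgc.integral_hasStrictDerivAt 0 s).hasDerivAt.const_add _
    exact a1.smul a2
  have hEq : ∀ s ∈ Set.Icc 0 t, Real.exp (-ν * (t - s)) • T (t - s) (f s + ν • u s) =
      (Real.exp (-ν * (t - s)) • g s +
        (Real.exp (-ν * (t - s)) * ν) • (T t u0 + ∫ r in (0:ℝ)..s, g r)) := by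
    intro s hs
    rw [← key s hs, hgeq s hs, map_add, map_smul, smul_add, smul_smul]
  have hftc := intervalIntegral.integral_eq_sub_of_hasDerivAt_of_le ht
    (f := fun s => Real.exp (-ν * (t - s)) • (T t u0 + ∫ r in (0:ℝ)..s, g r))
    (f' := fun s => Real.exp (-ν * (t - s)) • T (t - s) (f s + ν • u s))
    (fun s _ => (hd s).continuousAt.continuousWithinAt)
    (fun s hs => by
      have := hd s
      rw [← hEq s (Set.Ioo_subset_Icc_self hs)] at this
      exact this)
    (ContinuousOn.intervalIntegrable_of_Icc ht
      (ContinuousOn.smul (by fun_prop) hgu))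
  have kt := key t ⟨ht, le_rfl⟩
  rw [hftc]
  simp only [← kt]
  simp [h0]

/-- a continuous `K`-valued function is a mild solution for `(S, F)` iff
it is a mild solution for the rescaled semigroup `(e^{-μt}S(t))` and the shifted
nonlinearity `F + μ·id`. -/
theorem mild_solution_scaling
    {E : Type*} [NormedAddCommGroup E] [NormedSpace ℝ E] [CompleteSpace E]
    (S : ℝ → E →L[ℝ] E) (hS : IsC0Semigroup S)
    (K : Set E) (F : E → E) (hF : ContinuousOn F K)
    (μ : ℝ) (u0 : E) (hu0 : u0 ∈ K)
    (u : ℝ → E) (hu : ContinuousOn u (Set.Ici 0)) (huK : ∀ t : ℝ, 0 ≤ t → u t ∈ K) :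
    (∀ t : ℝ, 0 ≤ t → u t = S t u0 + ∫ s in (0:ℝ)..t, S (t - s) (F (u s))) ↔
    (∀ t : ℝ, 0 ≤ t → u t = Real.exp (-μ * t) • S t u0 +
      ∫ s in (0:ℝ)..t, Real.exp (-μ * (t - s)) • S (t - s) (F (u s) + μ • u s)) := by
  obtain ⟨h0, hadd, hT⟩ := id hS
  have hf : ContinuousOn (fun s => F (u s)) (Set.Ici 0) := hF.comp hu (fun t ht => huK t ht)
  constructor
  · intro h
    exact mild_aux S hS (fun s => F (u s)) hf μ u0 u hu h
  · intro h t ht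
    have hS' : IsC0Semigroup (fun t => Real.exp (-μ * t) • S t) := by
      refine ⟨by simp [h0], ?_, ?_⟩
      · intro s t hs ht
        ext x
        simp [hadd s t hs ht, mul_add, Real.exp_add, smul_smul]
        rw [mul_comm]
      · intro x
        exact ContinuousOn.smul (by fun_prop) (hT x)
    have := mild_aux _ hS' (fun s => F (u s) + μ • u s) (hf.add (hu.const_smul μ)) (-μ) u0 u hu
      h t ht
    rw [this]
    congr 1
    · simp [smul_smul, ← Real.exp_add]
    · apply intervalIntegral.integral_congr
      intro s _
      simp [smul_smul, ← Real.exp_add]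
end
end

section
/- Let E be an ordered Banach space with normal positive cone E₊, let (S(t))_{t≥0} be a positive C₀-semigroup on E, let u̲ ≤ ū in E, let F : [u̲,ū] → E be continuous and increasing, and assume hypothesis (H): for all t ≥ 0, u̲ ≤ S(t)u̲ + ∫₀ᵗ S(s)F(u̲) ds and S(t)ū + ∫₀ᵗ S(s)F(ū) ds ≤ ū. Assume either E has order continuous norm or S(t) is compact for every t > 0. Let u₀, ũ₀ ∈ [u̲,ū] with u₀ ≤ ũ₀, let u_min (resp. ũ_min) be the minimal mild solution with initial value u₀ (resp. ũ₀), i.e. the mild solution with values in [u̲,ū] that is dominated pointwise on [0,∞) by every mild solution with values in [u̲,ū] and the same initial value, and define maximal mild solutions u_max, ũ_max analogously. Then u_min(t) ≤ ũ_min(t) and u_max(t) ≤ ũ_max(t) for all t ≥ 0. -/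
open MeasureTheory Filter Topology

noncomputable section

set_option linter.unusedSectionVars false

namespace MMS

variable {E : Type*} [NormedAddCommGroup E] [NormedSpace ℝ E]

/-- extended semigroup -/
def SS (S : ℝ → E →L[ℝ] E) (r : ℝ) : E →L[ℝ] E := S (max r 0)

/-- convolution -/
def K (S : ℝ → E →L[ℝ] E) (f : ℝ → E) (t : ℝ) : E := ∫ s in (0:ℝ)..t, SS S (t - s) (f s)

lemma le_refl' {P : Set E} (hP : IsProperCone P) (hne : P.Nonempty) (x : E) : coneLE P x x := by
  obtain ⟨y, hy⟩ := hne
  have := hP.2.2.1 0 le_rfl y hy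
  simpa [coneLE] using this

lemma le_trans' {P : Set E} (hP : IsProperCone P) {x y z : E} (h1 : coneLE P x y)
    (h2 : coneLE P y z) : coneLE P x z := by
  have := hP.2.1 _ h1 _ h2
  simpa [coneLE] using this

lemma le_antisymm' {P : Set E} (hP : IsProperCone P) {x y : E} (h1 : coneLE P x y)
    (h2 : coneLE P y x) : x = y := by
  have := hP.2.2.2 _ h1 (by simpa [coneLE] using h2)
  exact (sub_eq_zero.1 this).symm

lemma le_add' {P : Set E} (hP : IsProperCone P) {x y z w : E} (h1 : coneLE P x y)
    (h2 : coneLE P z w) : coneLE P (x + z) (y + w) := by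
  have := hP.2.1 _ h1 _ h2
  unfold coneLE
  rwa [add_sub_add_comm]

lemma isClosed_ge {P : Set E} (hP : IsProperCone P) (a : E) : IsClosed {x | coneLE P a x} :=
  hP.1.preimage (continuous_id.sub continuous_const)

lemma isClosed_le {P : Set E} (hP : IsProperCone P) (a : E) : IsClosed {x | coneLE P x a} :=
  hP.1.preimage (continuous_const.sub continuous_id)

lemma convex_P {P : Set E} (hP : IsProperCone P) : Convex ℝ P := by
  intro x hx y hy a b ha hb _
  exact hP.2.1 _ (hP.2.2.1 a ha x hx) _ (hP.2.2.1 b hb y hy)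

/-- monotone sequence in compact set converges -/
lemma mono_conv {P : Set E} (hP : IsProperCone P) (hne : P.Nonempty) {x : ℕ → E}
    (hx : ∀ n, coneLE P (x n) (x (n+1))) {C : Set E} (hC : IsCompact C) (hxC : ∀ n, x n ∈ C) :
    ∃ l, Tendsto x atTop (𝓝 l) := by
  have hmono : ∀ n m, n ≤ m → coneLE P (x n) (x m) := by
    intro n m h
    induction m, h using Nat.le_induction with
    | base => exact le_refl' hP hne _
    | succ m _ ih => exact le_trans' hP ih (hx m)
  have hub : ∀ a, MapClusterPt a atTop x → ∀ n, coneLE P (x n) a := by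
    intro a ha n
    have : ClusterPt a (𝓟 {y | coneLE P (x n) y}) := by
      refine ClusterPt.mono ha ?_
      rw [le_principal_iff, mem_map]
      filter_upwards [eventually_ge_atTop n] with m hm using hmono n m hm
    exact (isClosed_ge hP (x n)).closure_subset (mem_closure_iff_clusterPt.2 this)
  have hlub : ∀ a b, MapClusterPt a atTop x → (∀ n, coneLE P (x n) b) → coneLE P a b := by
    intro a b ha hb
    have : ClusterPt a (𝓟 {y | coneLE P y b}) := by
      refine ClusterPt.mono ha ?_
      rw [le_principal_iff, mem_map]
      exact Eventually.of_forall hb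
    exact (isClosed_le hP b).closure_subset (mem_closure_iff_clusterPt.2 this)
  obtain ⟨a, haC, ha⟩ := hC.exists_mapClusterPt (u := x) (f := atTop)
    (by rw [le_principal_iff, mem_map]; exact Eventually.of_forall hxC)
  refine ⟨a, hC.tendsto_nhds_of_unique_mapClusterPt (Eventually.of_forall hxC) ?_⟩
  intro b _ hb
  exact le_antisymm' hP (hlub b a hb (hub a ha)) (hlub a b ha (hub b hb))

variable [CompleteSpace E]

lemma S_bdd {S : ℝ → E →L[ℝ] E} (hS : IsC0Semigroup S) (T : ℝ) :
    ∃ M, 0 ≤ M ∧ ∀ r ≤ T, ‖SS S r‖ ≤ M := by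
  have : ∃ C', ∀ i : Set.Icc (0:ℝ) (max T 0), ‖S i‖ ≤ C' := by
    apply banach_steinhaus
    intro x
    have hc : ContinuousOn (fun t => S t x) (Set.Icc 0 (max T 0)) :=
      (hS.2.2 x).mono (fun t ht => ht.1)
    obtain ⟨C, hC⟩ := isCompact_Icc.exists_bound_of_continuousOn hc
    exact ⟨C, fun i => hC i i.2⟩
  obtain ⟨C, hC⟩ := this
  refine ⟨max C 0, le_max_right _ _, fun r hr => ?_⟩
  exact (hC ⟨max r 0, le_max_right _ _, max_le_max_right 0 hr⟩).trans (le_max_left _ _)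

lemma SS_cont {S : ℝ → E →L[ℝ] E} (hS : IsC0Semigroup S) (x : E) :
    Continuous fun t => SS S t x := by
  have : Continuous ((fun t => S t x) ∘ fun t : ℝ => max t 0) :=
    (hS.2.2 x).comp_continuous (by fun_prop) (fun t => Set.mem_Ici.2 (le_max_right _ _))
  exact this

lemma SS_joint {S : ℝ → E →L[ℝ] E} (hS : IsC0Semigroup S) :
    Continuous fun p : ℝ × E => SS S p.1 p.2 := by
  rw [continuous_iff_continuousAt]
  rintro ⟨r, x⟩
  obtain ⟨M, hM0, hM⟩ := S_bdd hS (r + 1)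
  have h1 : Tendsto (fun p : ℝ × E => SS S p.1 (p.2 - x)) (𝓝 (r, x)) (𝓝 0) := by
    have h2 : Tendsto (fun p : ℝ × E => M * ‖p.2 - x‖) (𝓝 (r, x)) (𝓝 0) := by
      have : Continuous (fun p : ℝ × E => M * ‖p.2 - x‖) := by fun_prop
      simpa using this.tendsto (r, x)
    refine squeeze_zero_norm' ?_ h2
    have : ∀ᶠ p : ℝ × E in 𝓝 (r, x), p.1 < r + 1 :=
      continuous_fst.tendsto (r, x) |>.eventually_lt_const (by simp)
    filter_upwards [this] with p hp
    exact ((SS S p.1).le_opNorm _).trans (by gcongr; exact hM _ hp.le)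
  have h3 : Tendsto (fun p : ℝ × E => SS S p.1 x) (𝓝 (r, x)) (𝓝 (SS S r x)) :=
    ((SS_cont hS x).comp continuous_fst).tendsto (r, x)
  have := h1.add h3
  simpa [ContinuousAt] using this

lemma meas {S : ℝ → E →L[ℝ] E} (hS : IsC0Semigroup S) {f : ℝ → E} (hf : StronglyMeasurable f)
    (t : ℝ) : StronglyMeasurable fun s => SS S (t - s) (f s) :=
  (SS_joint hS).comp_stronglyMeasurable
    (((continuous_const.sub continuous_id).stronglyMeasurable).prodMk hf)

lemma bnd {S : ℝ → E →L[ℝ] E} {f : ℝ → E} {C M T : ℝ} (hC : ∀ s, ‖f s‖ ≤ C) (hM0 : 0 ≤ M)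
    (hM : ∀ r ≤ T, ‖SS S r‖ ≤ M) {r : ℝ} (hr : r ≤ T) (s : ℝ) : ‖SS S r (f s)‖ ≤ M * C :=
  ((SS S r).le_opNorm _).trans (by
    gcongr
    · exact hM _ hr
    · exact hC s)

lemma integ {S : ℝ → E →L[ℝ] E} (hS : IsC0Semigroup S) {f : ℝ → E} (hf : StronglyMeasurable f)
    {C : ℝ} (hC : ∀ s, ‖f s‖ ≤ C) (t a b : ℝ) :
    IntervalIntegrable (fun s => SS S (t - s) (f s)) volume a b := by
  obtain ⟨M, hM0, hM⟩ := S_bdd hS (t - min a b)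
  refine (intervalIntegrable_const (c := M * C)).mono_fun (meas hS hf t).aestronglyMeasurable ?_
  filter_upwards [ae_restrict_mem measurableSet_uIoc] with s hs
  refine (bnd hC hM0 hM (by have := hs.1; linarith) s).trans (le_abs_self _)

lemma K_cont {S : ℝ → E →L[ℝ] E} (hS : IsC0Semigroup S) {f : ℝ → E} (hf : StronglyMeasurable f)
    {C : ℝ} (hC : ∀ s, ‖f s‖ ≤ C) : Continuous (K S f) := by
  rw [continuous_iff_continuousAt]
  intro t
  obtain ⟨M, hM0, hM⟩ := S_bdd hS (t + 1 - min (-1) (t - 1))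
  have := intervalIntegral.continuousAt_parametric_primitive_of_dominated (μ := volume)
    (F := fun x s => SS S (x - s) (f s)) (fun _ => M * C)
    (min (-1) (t-1)) (max 1 (t + 1)) (a₀ := 0) (b₀ := t) (x₀ := t)
    (fun x => (meas hS hf x).aestronglyMeasurable)
    (by
      have : ∀ᶠ x : ℝ in 𝓝 t, x < t + 1 := eventually_lt_nhds (by simp)
      filter_upwards [this] with x hx
      filter_upwards [ae_restrict_mem measurableSet_uIoc] with s hs
      refine bnd hC hM0 hM ?_ s
      have h1 := hs.1
      rw [min_eq_left (by simp)] at h1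
      linarith)
    intervalIntegrable_const
    (Eventually.of_forall fun s => ((SS_cont hS (f s)).comp
      (continuous_id.sub continuous_const)).continuousAt)
    (by constructor <;> simp) (by constructor <;> simp) (by simp)
  exact this.comp (f := fun t : ℝ => (t, t)) (by fun_prop)

lemma K_mono {P : Set E} {S : ℝ → E →L[ℝ] E} (hP : IsProperCone P) (hS : IsPositiveSemigroup P S)
    {f g : ℝ → E} (hf : StronglyMeasurable f) (hg : StronglyMeasurable g)
    {C : ℝ} (hfC : ∀ s, ‖f s‖ ≤ C) (hgC : ∀ s, ‖g s‖ ≤ C) (hfg : ∀ s, coneLE P (f s) (g s))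
    {t : ℝ} (ht : 0 ≤ t) : coneLE P (K S f t) (K S g t) := by
  unfold coneLE K
  rw [← intervalIntegral.integral_sub (integ hS.1 hg hgC t 0 t) (integ hS.1 hf hfC t 0 t)]
  have hpos : ∀ s, SS S (t - s) (g s) - SS S (t - s) (f s) ∈ P := by
    intro s
    rw [← map_sub]
    exact hS.2 _ (le_max_right _ _) _ (hfg s)
  rcases ht.eq_or_lt with rfl | ht
  · simp only [intervalIntegral.integral_same]
    simpa using hP.2.2.1 0 le_rfl _ (hpos 0)
  have hI := (integ hS.1 hg hgC t 0 t).sub (integ hS.1 hf hfC t 0 t)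
  rw [intervalIntegrable_iff, Set.uIoc_of_le ht.le] at hI
  have := (convex_P hP).set_average_mem hP.1 (μ := volume) (t := Set.Ioc 0 t)
    (by simp [ht]) (by simp) (Eventually.of_forall hpos) hI
  rw [setAverage_eq] at this
  have h2 := hP.2.2.1 t ht.le _ this
  rw [intervalIntegral.integral_of_le ht.le]
  simpa [smul_smul, ht.le, ht.ne', measureReal_def] using h2

lemma K_tendsto {S : ℝ → E →L[ℝ] E} (hS : IsC0Semigroup S) {f : ℕ → ℝ → E} {g : ℝ → E}
    (hf : ∀ n, StronglyMeasurable (f n)) {C : ℝ} (hC : ∀ n s, ‖f n s‖ ≤ C)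
    (hl : ∀ s, Tendsto (fun n => f n s) atTop (𝓝 (g s))) (t : ℝ) :
    Tendsto (fun n => K S (f n) t) atTop (𝓝 (K S g t)) := by
  obtain ⟨M, hM0, hM⟩ := S_bdd hS (t - min 0 t)
  refine intervalIntegral.tendsto_integral_filter_of_dominated_convergence (fun _ => M * C)
    (Eventually.of_forall fun n => (meas hS (hf n) t).aestronglyMeasurable)
    (Eventually.of_forall fun n => Eventually.of_forall fun s hs => 
      bnd (hC n) hM0 hM (by have := hs.1; linarith) s)
    intervalIntegrable_const
    (Eventually.of_forall fun s _ => ((SS S (t - s)).continuous.tendsto _).comp (hl s))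

lemma K_compact {S : ℝ → E →L[ℝ] E} (hS : IsC0Semigroup S)
    (hc : ∀ t : ℝ, 0 < t → IsCompactOperator (⇑(S t))) (C : ℝ) {t : ℝ} (ht : 0 < t) :
    TotallyBounded {y | ∃ f : ℝ → E, StronglyMeasurable f ∧ (∀ s, ‖f s‖ ≤ C) ∧ y = K S f t} := by
  obtain ⟨M, hM0, hM⟩ := S_bdd hS t
  rw [Metric.totallyBounded_iff]
  intro ε hε
  obtain ⟨δ, hδ0, hδt, hδ⟩ : ∃ δ, 0 < δ ∧ δ < t ∧ M * |C| * δ < ε / 2 := by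
    refine ⟨min (t / 2) (ε / 4 / (M * |C| + 1)), by positivity, 
      (min_le_left _ _).trans_lt (by linarith), ?_⟩
    have h0 : 0 ≤ M * |C| := by positivity
    calc M * |C| * min (t / 2) (ε / 4 / (M * |C| + 1))
        ≤ (M * |C| + 1) * (ε / 4 / (M * |C| + 1)) := by
          gcongr
          · linarith
          · exact min_le_right _ _
      _ = ε / 4 := by field_simp
      _ < ε / 2 := by linarith
  obtain ⟨Q, hQ, hQs⟩ := (hc δ hδ0).image_subset_compact_of_bounded
    (Metric.isBounded_closedBall (x := (0:E)) (r := M * C * (t - δ)))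
  obtain ⟨Z, hZ, hZs⟩ := Metric.totallyBounded_iff.1 hQ.totallyBounded (ε / 2) (by linarith)
  refine ⟨Z, hZ, ?_⟩
  rintro y ⟨f, hf, hfC, rfl⟩
  have hsplit : K S f t = S δ (K S f (t - δ)) + ∫ s in (t - δ)..t, SS S (t - s) (f s) := by
    unfold K
    rw [← intervalIntegral.integral_add_adjacent_intervals (integ hS hf hfC t 0 (t - δ))
      (integ hS hf hfC t (t - δ) t),
      ← ContinuousLinearMap.intervalIntegral_comp_comm _ (integ hS hf hfC (t - δ) 0 (t - δ))]
    congr 1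
    refine intervalIntegral.integral_congr fun s hs => ?_
    rw [Set.uIcc_of_le (by linarith)] at hs
    have h1 : 0 ≤ t - δ - s := by linarith [hs.2]
    have h2 : 0 ≤ t - s := by linarith [hs.2]
    simp only [SS, max_eq_left h1, max_eq_left h2]
    rw [show t - s = δ + (t - δ - s) by ring, hS.2.1 _ _ hδ0.le h1]
    rfl
  have hb1 : ‖K S f (t - δ)‖ ≤ M * C * (t - δ) := by
    have := intervalIntegral.norm_integral_le_of_norm_le_const (a := 0) (b := t - δ)
      (f := fun s => SS S (t - δ - s) (f s)) (C := M * C) (fun s hs => by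
        rw [Set.uIoc_of_le (by linarith)] at hs
        exact bnd hfC hM0 hM (by linarith [hs.1]) s)
    rwa [sub_zero, abs_of_pos (by linarith)] at this
  have hb2 : ‖∫ s in (t - δ)..t, SS S (t - s) (f s)‖ < ε / 2 := by
    have := intervalIntegral.norm_integral_le_of_norm_le_const (a := t - δ) (b := t)
      (f := fun s => SS S (t - s) (f s)) (C := M * |C|) (fun s hs => by
        rw [Set.uIoc_of_le (by linarith)] at hs
        exact bnd (fun s => (hfC s).trans (le_abs_self _)) hM0 hM (by linarith [hs.1]) s)
    rw [sub_sub_cancel, abs_of_pos hδ0] at this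
    exact this.trans_lt hδ
  have hmem : S δ (K S f (t - δ)) ∈ Q := hQs ⟨_, by simpa using hb1, rfl⟩
  obtain ⟨z, hz, hz2⟩ := Set.mem_iUnion₂.1 (hZs hmem)
  refine Set.mem_iUnion₂.2 ⟨z, hz, ?_⟩
  rw [Metric.mem_ball, dist_eq_norm] at hz2 ⊢
  rw [hsplit, add_sub_right_comm]
  exact (norm_add_le _ _).trans_lt (by linarith)

/-- the fixed point map extended to all of the real line -/
def G (S : ℝ → E →L[ℝ] E) (F : E → E) (u0 : E) (u : ℝ → E) (t : ℝ) : E :=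
  SS S t u0 + K S (fun s => F (u s)) (max t 0)

lemma fpm_eq {S : ℝ → E →L[ℝ] E} {F : E → E} {u0 : E} {u v : ℝ → E} 
    (huv : ∀ s, 0 ≤ s → u s = v s) {t : ℝ} (ht : 0 ≤ t) :
    fixedPointMap S F u0 u t = G S F u0 v t := by
  unfold fixedPointMap G K SS
  rw [max_eq_left ht]
  congr 1
  refine intervalIntegral.integral_congr fun s hs => ?_
  rw [Set.uIcc_of_le ht] at hs
  have h2 : 0 ≤ t - s := by linarith [hs.2]
  simp only [max_eq_left h2, huv s hs.1]

lemma K_const {S : ℝ → E →L[ℝ] E} (x : E) {t : ℝ} (ht : 0 ≤ t) :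
    K S (fun _ => x) t = ∫ s in (0:ℝ)..t, S s x := by
  unfold K
  rw [intervalIntegral.integral_comp_sub_left (fun r => SS S r x) t]
  simp only [sub_self, sub_zero]
  refine intervalIntegral.integral_congr fun s hs => ?_
  rw [Set.uIcc_of_le ht] at hs
  simp only [SS, max_eq_left hs.1]

lemma key (P : Set E) (S : ℝ → E →L[ℝ] E) (F : E → E) (ua ub : E)
    (hP : IsProperCone P) (hN : IsNormalCone P) (hS : IsPositiveSemigroup P S)
    (hab : coneLE P ua ub)
    (hFc : ContinuousOn F (orderInterval P ua ub))
    (hFm : ∀ x ∈ orderInterval P ua ub, ∀ y ∈ orderInterval P ua ub,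
      coneLE P x y → coneLE P (F x) (F y))
    (hH : ∀ t : ℝ, 0 ≤ t →
      coneLE P ua (S t ua + ∫ s in (0:ℝ)..t, S s (F ua)) ∧
      coneLE P (S t ub + ∫ s in (0:ℝ)..t, S s (F ub)) ub)
    (halt : OrderContinuousNorm P ∨ ∀ t : ℝ, 0 < t → IsCompactOperator (⇑(S t)))
    (u0 tu0 : E) (htu0 : tu0 ∈ orderInterval P ua ub)
    (h00 : coneLE P u0 tu0) (v : ℝ → E) (hv : IsMildSolution P S F ua ub u0 v) :
    ∃ w, IsMildSolution P S F ua ub tu0 w ∧ ∀ t, 0 ≤ t → coneLE P (v t) (w t) := by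
  have hne : P.Nonempty := ⟨_, hab⟩
  set I := orderInterval P ua ub with hI
  have hIcl : IsClosed I := (isClosed_ge hP ua).inter (isClosed_le hP ub)
  have haI : ua ∈ I := ⟨le_refl' hP hne _, hab⟩
  have hbI : ub ∈ I := ⟨hab, le_refl' hP hne _⟩
  obtain ⟨C, hC⟩ := hN (F ua) (F ub)
  have hFC : ∀ x ∈ I, ‖F x‖ ≤ C := fun x hx => hC _ ⟨hFm _ haI _ hx hx.1, hFm _ hx _ hbI hx.2⟩
  have hSmono : ∀ t x y, coneLE P x y → coneLE P (SS S t x) (SS S t y) := by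
    intro t x y h
    unfold coneLE
    rw [← map_sub]
    exact hS.2 _ (le_max_right _ _) _ h
  have hGmono : ∀ (x y : E) (u w : ℝ → E), coneLE P x y → (∀ s, u s ∈ I) → (∀ s, w s ∈ I) →
      StronglyMeasurable (fun s => F (u s)) → StronglyMeasurable (fun s => F (w s)) →
      (∀ s, coneLE P (u s) (w s)) → ∀ t, coneLE P (G S F x u t) (G S F y w t) := by
    intro x y u w hxy hu hw hum hwm huw t
    exact le_add' hP (hSmono t _ _ hxy) (K_mono hP hS hum hwm (fun s => hFC _ (hu s))
      (fun s => hFC _ (hw s)) (fun s => hFm _ (hu s) _ (hw s) (huw s)) (le_max_right _ _))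
  have hGc : ∀ (u : ℝ → E), (∀ s, u s ∈ I) → StronglyMeasurable (fun s => F (u s)) →
      Continuous (G S F tu0 u) := by
    intro u hu hum
    exact (SS_cont hS.1 tu0).add ((K_cont hS.1 hum (fun s => hFC _ (hu s))).comp
      (continuous_id.max continuous_const))
  have hGI : ∀ (u : ℝ → E), (∀ s, u s ∈ I) → StronglyMeasurable (fun s => F (u s)) →
      ∀ t, G S F tu0 u t ∈ I := by
    intro u hu hum t
    constructor
    · refine le_trans' hP (hH (max t 0) (le_max_right _ _)).1 ?_
      rw [← K_const _ (le_max_right _ _)]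
      exact hGmono ua tu0 (fun _ => ua) u htu0.1 (fun _ => haI) hu stronglyMeasurable_const hum
        (fun s => (hu s).1) t
    · refine le_trans' hP ?_ (hH (max t 0) (le_max_right _ _)).2
      rw [← K_const _ (le_max_right _ _)]
      exact hGmono tu0 ub u (fun _ => ub) htu0.2 hu (fun _ => hbI) hum stronglyMeasurable_const
        (fun s => (hu s).2) t
  have hFm' : ∀ u : ℝ → E, Continuous u → (∀ s, u s ∈ I) →
      StronglyMeasurable (fun s => F (u s)) := fun u hu huI =>
    (hFc.comp_continuous hu huI).stronglyMeasurable
  let v' : ℝ → E := fun t => v (max t 0)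
  let g : ℕ → ℝ → E := fun n => (G S F tu0)^[n] v'
  have hg0 : g 0 = v' := rfl
  have hgs : ∀ n, g (n+1) = G S F tu0 (g n) := fun n => Function.iterate_succ_apply' _ _ _
  have hg : ∀ n, Continuous (g n) ∧ ∀ t, g n t ∈ I := by
    intro n
    induction n with
    | zero =>
      refine ⟨?_, fun t => hv.2.1 _ (le_max_right _ _)⟩
      exact hv.1.comp_continuous (by fun_prop) (fun t => Set.mem_Ici.2 (le_max_right _ _))
    | succ n ih =>
      rw [hgs]
      exact ⟨hGc _ ih.2 (hFm' _ ih.1 ih.2), hGI _ ih.2 (hFm' _ ih.1 ih.2)⟩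
  have hgm : ∀ n, StronglyMeasurable (fun s => F (g n s)) := fun n => hFm' _ (hg n).1 (hg n).2
  have hmono : ∀ n t, coneLE P (g n t) (g (n+1) t) := by
    intro n
    induction n with
    | zero =>
      intro t
      have h1 : g 0 t = G S F u0 (g 0) t := by
        have : G S F u0 (g 0) t = G S F u0 (g 0) (max t 0) := by simp [G, SS]
        rw [this, ← fpm_eq (u := v) (fun s hs => by simp [hg0, v', max_eq_left hs])
          (le_max_right _ _), ← hv.2.2 _ (le_max_right _ _)]
        rfl
      rw [hgs, h1]
      exact hGmono _ _ _ _ h00 (hg 0).2 (hg 0).2 (hgm 0) (hgm 0) (fun s => le_refl' hP hne _) t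
    | succ n ih =>
      intro t
      rw [hgs (n+1)]
      nth_rw 1 [hgs n]
      exact hGmono _ _ _ _ (le_refl' hP hne _) (hg n).2 (hg (n+1)).2 (hgm n) (hgm (n+1)) ih t
  have hconv : ∀ t, ∃ l, Tendsto (fun n => g n t) atTop (𝓝 l) := by
    intro t
    rcases halt with h | h
    · exact h _ ua ub (fun n => hmono n t) (fun n => (hg n).2 t)
    · suffices ∃ l, Tendsto (fun n => g (n+1) t) atTop (𝓝 l) by
        obtain ⟨l, hl⟩ := this
        exact ⟨l, (tendsto_add_atTop_iff_nat 1).1 hl⟩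
      rcases le_or_gt t 0 with ht | ht
      · refine ⟨SS S t tu0, ?_⟩
        have : ∀ n, g (n+1) t = SS S t tu0 := by
          intro n
          rw [hgs]
          simp [G, K, max_eq_right ht]
        simp only [this]
        exact tendsto_const_nhds
      · have hK := K_compact hS.1 h C ht
        have hcomp : IsCompact ((fun y => SS S t tu0 + y) '' closure
            {y | ∃ f : ℝ → E, StronglyMeasurable f ∧ (∀ s, ‖f s‖ ≤ C) ∧ y = K S f t}) :=
          (hK.closure.isCompact_of_isClosed isClosed_closure).image (by fun_prop)
        refine mono_conv hP hne (fun n => hmono (n+1) t) hcomp (fun n => ?_)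
        refine ⟨K S (fun s => F (g n s)) t, subset_closure
          ⟨_, hgm n, fun s => hFC _ ((hg n).2 s), rfl⟩, ?_⟩
        rw [hgs]
        simp only [G, max_eq_left ht.le]
  choose w hw using hconv
  have hwI : ∀ t, w t ∈ I := fun t =>
    hIcl.mem_of_tendsto (hw t) (Eventually.of_forall fun n => (hg n).2 t)
  have hFw : ∀ s, Tendsto (fun n => F (g n s)) atTop (𝓝 (F (w s))) := by
    intro s
    exact ((hFc (w s) (hwI s)).tendsto).comp (tendsto_nhdsWithin_iff.2
      ⟨hw s, Eventually.of_forall fun n => (hg n).2 s⟩)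
  have hwm : StronglyMeasurable (fun s => F (w s)) :=
    stronglyMeasurable_of_tendsto atTop hgm (tendsto_pi_nhds.2 hFw)
  have hweq : ∀ t, w t = G S F tu0 w t := by
    intro t
    refine tendsto_nhds_unique ((tendsto_add_atTop_iff_nat 1).2 (hw t)) ?_
    simp only [hgs]
    exact tendsto_const_nhds.add 
      (K_tendsto hS.1 hgm (fun n s => hFC _ ((hg n).2 s)) hFw (max t 0))
  refine ⟨w, ⟨?_, fun t _ => hwI t, fun t ht => ?_⟩, fun t ht => ?_⟩
  · have : w = G S F tu0 w := funext hweq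
    rw [this]
    exact (hGc w hwI hwm).continuousOn
  · rw [fpm_eq (fun _ _ => rfl) ht]
    exact hweq t
  · have hle : ∀ n, coneLE P (v t) (g n t) := by
      intro n
      induction n with
      | zero => 
        simp only [hg0, v', max_eq_left ht]
        exact le_refl' hP hne _
      | succ n ih => exact le_trans' hP ih (hmono n t)
    exact (isClosed_ge hP (v t)).mem_of_tendsto (hw t) (Eventually.of_forall hle)

/-- the negated cone -/
def N (P : Set E) : Set E := {x | -x ∈ P}

lemma N_le {P : Set E} {x y : E} : coneLE (N P) x y ↔ coneLE P y x := by
  simp [N, coneLE]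

lemma N_int {P : Set E} {x y : E} : orderInterval (N P) x y = orderInterval P y x := by
  ext z
  simp only [orderInterval, N_le, Set.mem_ofPred_eq, and_comm]

lemma N_proper {P : Set E} (hP : IsProperCone P) : IsProperCone (N P) := by
  refine ⟨hP.1.preimage continuous_neg, fun x hx y hy => ?_, fun t ht x hx => ?_, 
    fun x hx hy => ?_⟩
  · have := hP.2.1 _ hx _ hy
    simpa [N, add_comm] using this
  · have := hP.2.2.1 t ht _ hx
    simpa [N] using this
  · have := hP.2.2.2 _ hx hy
    simpa using this

lemma N_ocn {P : Set E} (h : OrderContinuousNorm P) : OrderContinuousNorm (N P) := by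
  intro x a b hx hxI
  obtain ⟨l, hl⟩ := h (fun n => - x n) (-a) (-b) (fun n => by
      have := hx n
      simp only [coneLE, N, Set.mem_ofPred_eq] at this ⊢
      convert this using 1
      abel) (fun n => by
      have := hxI n
      simp only [orderInterval, coneLE, N, Set.mem_ofPred_eq] at this ⊢
      refine ⟨?_, ?_⟩
      · convert this.1 using 1
        abel
      · convert this.2 using 1
        abel)
  exact ⟨-l, by simpa using hl.neg⟩

lemma N_mild {P : Set E} {S : ℝ → E →L[ℝ] E} {F : E → E} {ua ub u0 : E} {u : ℝ → E} :
    IsMildSolution (N P) S F ub ua u0 u ↔ IsMildSolution P S F ua ub u0 u := by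
  simp only [IsMildSolution, N_int]

end MMS

/-- minimal and maximal mild solutions depend monotonically on the
initial value. -/
theorem minimal_maximal_solutions_monotone_in_initial_value
    {E : Type*} [NormedAddCommGroup E] [NormedSpace ℝ E] [CompleteSpace E]
    (P : Set E) (S : ℝ → E →L[ℝ] E) (F : E → E) (ua ub : E)
    (hP : IsProperCone P) (hN : IsNormalCone P) (hS : IsPositiveSemigroup P S)
    (hab : coneLE P ua ub)
    (hFc : ContinuousOn F (orderInterval P ua ub))
    (hFm : ∀ x ∈ orderInterval P ua ub, ∀ y ∈ orderInterval P ua ub,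
      coneLE P x y → coneLE P (F x) (F y))
    (hH : ∀ t : ℝ, 0 ≤ t →
      coneLE P ua (S t ua + ∫ s in (0:ℝ)..t, S s (F ua)) ∧
      coneLE P (S t ub + ∫ s in (0:ℝ)..t, S s (F ub)) ub)
    (halt : OrderContinuousNorm P ∨ ∀ t : ℝ, 0 < t → IsCompactOperator (⇑(S t)))
    (u0 tu0 : E) (hu0 : u0 ∈ orderInterval P ua ub) (htu0 : tu0 ∈ orderInterval P ua ub)
    (h00 : coneLE P u0 tu0)
    (umin tumin umax tumax : ℝ → E)
    (humin : IsMildSolution P S F ua ub u0 umin ∧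
      ∀ u : ℝ → E, IsMildSolution P S F ua ub u0 u → ∀ t : ℝ, 0 ≤ t → coneLE P (umin t) (u t))
    (htumin : IsMildSolution P S F ua ub tu0 tumin ∧
      ∀ u : ℝ → E, IsMildSolution P S F ua ub tu0 u → ∀ t : ℝ, 0 ≤ t → coneLE P (tumin t) (u t))
    (humax : IsMildSolution P S F ua ub u0 umax ∧
      ∀ u : ℝ → E, IsMildSolution P S F ua ub u0 u → ∀ t : ℝ, 0 ≤ t → coneLE P (u t) (umax t))
    (htumax : IsMildSolution P S F ua ub tu0 tumax ∧
      ∀ u : ℝ → E, IsMildSolution P S F ua ub tu0 u → ∀ t : ℝ, 0 ≤ t → coneLE P (u t) (tumax t)) :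
    ∀ t : ℝ, 0 ≤ t → coneLE P (umin t) (tumin t) ∧ coneLE P (umax t) (tumax t) := by
  intro t ht
  constructor
  · obtain ⟨w, hw, hle⟩ := MMS.key (MMS.N P) S F ub ua (MMS.N_proper hP)
      (fun a b => by rw [MMS.N_int]; exact hN b a)
      ⟨hS.1, fun t ht x hx => by
        have := hS.2 t ht _ hx
        simpa [MMS.N] using this⟩
      (MMS.N_le.2 hab) (by rw [MMS.N_int]; exact hFc)
      (by
        simp only [MMS.N_int, MMS.N_le]
        exact fun x hx y hy h => hFm y hy x hx h)
      (by
        simp only [MMS.N_le]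
        exact fun t ht => (hH t ht).symm)
      (halt.imp MMS.N_ocn id) tu0 u0 (by rw [MMS.N_int]; exact hu0) (MMS.N_le.2 h00) tumin
      (MMS.N_mild.2 htumin.1)
    exact MMS.le_trans' hP (humin.2 w (MMS.N_mild.1 hw) t ht) (MMS.N_le.1 (hle t ht))
  · obtain ⟨w, hw, hle⟩ := MMS.key P S F ua ub hP hN hS hab hFc hFm hH halt u0 tu0 htu0 h00 umax
      humax.1
    exact MMS.le_trans' hP (hle t ht) (htumax.2 w hw t ht)
end
end

section
/- Let E be an ordered Banach space with normal positive cone E₊ and let T > 0. Let (vₙ) be a sequence in C([0,T],E) with vₙ(t) ≤ v_{n+1}(t) for all n and all t ∈ [0,T], and let v ∈ C([0,T],E) be such that ‖vₙ(t) − v(t)‖ → 0 for every t ∈ [0,T]. Then vₙ → v uniformly on [0,T], i.e. sup_{t∈[0,T]} ‖vₙ(t) − v(t)‖ → 0 as n → ∞. -/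
open MeasureTheory Filter Topology

noncomputable section

theorem normal_const {E : Type*} [NormedAddCommGroup E] [NormedSpace ℝ E] [CompleteSpace E]
    (P : Set E) (hP : IsProperCone P) (hN : IsNormalCone P) :
    ∃ C : ℝ, 0 < C ∧ ∀ x y : E, x ∈ P → y - x ∈ P → ‖x‖ ≤ C * ‖y‖ := by
  obtain ⟨hcl, hadd, hsmul, hpt⟩ := hP
  by_contra! hcon
  have h1 : ∀ n : ℕ, ∃ x y : E, x ∈ P ∧ y - x ∈ P ∧ (2:ℝ) ^ n < ‖x‖ ∧ ‖y‖ = (1 / 2 : ℝ) ^ n := by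
    intro n
    obtain ⟨x, y, hx, hyx, hlt⟩ := hcon ((4:ℝ) ^ n) (by positivity)
    have hy : y ≠ 0 := by
      rintro rfl
      have : x = 0 := hpt x hx (by simpa using hyx)
      subst this
      simp at hlt
    have hy' : 0 < ‖y‖ := norm_pos_iff.mpr hy
    have hc : 0 < (1 / 2 : ℝ) ^ n / ‖y‖ := by positivity
    refine ⟨((1 / 2 : ℝ) ^ n / ‖y‖) • x, ((1 / 2 : ℝ) ^ n / ‖y‖) • y, hsmul _ hc.le _ hx, ?_, ?_, ?_⟩
    · rw [← smul_sub]
      exact hsmul _ hc.le _ hyx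
    · rw [norm_smul, Real.norm_of_nonneg hc.le]
      calc (2:ℝ) ^ n = ((1 / 2 : ℝ) ^ n / ‖y‖) * ((4:ℝ) ^ n * ‖y‖) := by
            field_simp
            rw [← mul_pow]
            norm_num
        _ < _ := mul_lt_mul_of_pos_left hlt hc
    · rw [norm_smul, Real.norm_of_nonneg hc.le]
      field_simp
  choose x y hx hyx hxn hyn using h1
  have h0 : (0:E) ∈ P := by simpa using hsmul 0 le_rfl _ (hx 0)
  have hy : ∀ n, y n ∈ P := fun n => by simpa using hadd _ (hyx n) _ (hx n)
  have hsum : Summable y := by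
    apply Summable.of_norm
    simp only [hyn]
    exact summable_geometric_of_lt_one (by norm_num) (by norm_num)
  have hfin : ∀ s : Finset ℕ, ∑ i ∈ s, y i ∈ P := by
    intro s
    induction s using Finset.induction_on with
    | empty => simpa using h0
    | insert a s ha ih =>
      rw [Finset.sum_insert ha]
      exact hadd _ (hy a) _ ih
  have hle : ∀ n, (∑' i, y i) - y n ∈ P := by
    intro n
    have ht : Tendsto (fun s : Finset ℕ => ∑ i ∈ s, y i - y n) atTop (𝓝 ((∑' i, y i) - y n)) :=
      hsum.hasSum.sub_const (y n)
    refine hcl.mem_of_tendsto ht ?_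
    filter_upwards [eventually_ge_atTop {n}] with s hs
    have hn : n ∈ s := hs (Finset.mem_singleton_self n)
    rw [← Finset.add_sum_erase s y hn, add_sub_cancel_left]
    exact hfin _
  obtain ⟨C, hC⟩ := hN 0 (∑' i, y i)
  obtain ⟨n, hn⟩ := pow_unbounded_of_one_lt C (one_lt_two : (1:ℝ) < 2)
  have := hC (x n) ⟨by simpa [coneLE] using hx n, by
    have := hadd _ (hle n) _ (hyx n)
    simpa [coneLE] using this⟩
  linarith [hxn n]

/-- Dini-type theorem: a monotone sequence of continuous functions on
`[0,T]` with values in an ordered Banach space with normal cone which converges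
pointwise to a continuous function converges uniformly. -/
theorem dini_ordered_banach
    {E : Type*} [NormedAddCommGroup E] [NormedSpace ℝ E] [CompleteSpace E]
    (P : Set E) (hP : IsProperCone P) (hN : IsNormalCone P)
    (T : ℝ) (hT : 0 < T)
    (v : ℕ → ℝ → E) (w : ℝ → E)
    (hvc : ∀ n, ContinuousOn (v n) (Set.Icc 0 T))
    (hwc : ContinuousOn w (Set.Icc 0 T))
    (hmono : ∀ n, ∀ t ∈ Set.Icc (0:ℝ) T, coneLE P (v n t) (v (n + 1) t))
    (hptwise : ∀ t ∈ Set.Icc (0:ℝ) T,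
      Filter.Tendsto (fun n => v n t) Filter.atTop (nhds (w t))) :
    TendstoUniformlyOn v w Filter.atTop (Set.Icc 0 T) := by
  obtain ⟨C, hC, hCle⟩ := normal_const P hP hN
  obtain ⟨hcl, hadd, hsmul, hpt⟩ := hP
  have h0 : (0:E) ∈ P := by
    simpa using hsmul 0 le_rfl _ (hmono 0 0 ⟨le_rfl, hT.le⟩)
  have hm : ∀ t ∈ Set.Icc (0:ℝ) T, ∀ m n, m ≤ n → v n t - v m t ∈ P := by
    intro t ht m n hmn
    induction n, hmn using Nat.le_induction with
    | base => simpa using h0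
    | succ n _ ih => simpa using hadd _ (hmono n t ht) _ ih
  have hlim : ∀ t ∈ Set.Icc (0:ℝ) T, ∀ m, w t - v m t ∈ P := by
    intro t ht m
    refine hcl.mem_of_tendsto ((hptwise t ht).sub_const (v m t)) ?_
    filter_upwards [eventually_ge_atTop m] with n hn
    exact hm t ht m n hn
  rw [← tendstoLocallyUniformlyOn_iff_tendstoUniformlyOn_of_compact isCompact_Icc,
    Metric.tendstoLocallyUniformlyOn_iff]
  intro ε hε t₀ ht₀
  have hd : 0 < ε / C := div_pos hε hC
  obtain ⟨N, hN'⟩ := ((Metric.tendsto_nhds.mp (hptwise t₀ ht₀)) _ hd).exists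
  have hcont : ContinuousWithinAt (fun t => ‖w t - v N t‖) (Set.Icc 0 T) t₀ :=
    ((hwc t₀ ht₀).sub (hvc N t₀ ht₀)).norm
  have hev : ∀ᶠ t in 𝓝[Set.Icc 0 T] t₀, ‖w t - v N t‖ < ε / C := by
    refine hcont.eventually_lt_const ?_
    rwa [dist_comm, dist_eq_norm] at hN'
  refine ⟨_, inter_mem hev self_mem_nhdsWithin, ?_⟩
  filter_upwards [eventually_ge_atTop N] with n hn t ht
  obtain ⟨h1, h2⟩ := ht
  have h1' : ‖w t - v N t‖ < ε / C := h1
  rw [dist_eq_norm]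
  calc ‖w t - v n t‖ ≤ C * ‖w t - v N t‖ :=
        hCle _ _ (hlim t h2 n) (by simpa using hm t h2 N n hn)
    _ < C * (ε / C) := mul_lt_mul_of_pos_left h1' hC
    _ = ε := by field_simp
end
end

section
/- Let E be an ordered Banach space with normal positive cone E₊, let (S(t))_{t≥0} be a positive C₀-semigroup on E that is exponentially stable, i.e. there exist M ≥ 1 and ω > 0 with ‖S(t)‖ ≤ M e^{−ωt} for all t ≥ 0. Let u̲ ≤ ū in E, let F : [u̲,ū] → E be continuous and increasing, and let u be a mild solution with values in [u̲,ū]. If u_∞ := lim_{t→∞} u(t) exists in E, then u_∞ = ∫₀^∞ S(s)F(u_∞) ds; in particular u_∞ is an equilibrium of the evolution equation (it satisfies Au_∞ = F(u_∞) where −A is the generator of the semigroup). -/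
open MeasureTheory Filter Topology

noncomputable section

theorem aux_cont_s12 {E : Type*} [NormedAddCommGroup E] [NormedSpace ℝ E]
    (S : ℝ → E →L[ℝ] E) (M : ℝ) (hb : ∀ t : ℝ, 0 ≤ t → ‖S t‖ ≤ M)
    (hc : ∀ x : E, ContinuousOn (fun t => S t x) (Set.Ici 0))
    (K : Set ℝ) (hK : K ⊆ Set.Ici 0) (g : ℝ → E) (hg : ContinuousOn g K) :
    ContinuousOn (fun t => S t (g t)) K := by
  intro a ha
  have h1 : Tendsto (fun t => S t (g a)) (𝓝[K] a) (𝓝 (S a (g a))) :=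
    ((hc (g a)).mono hK) a ha
  have h2 : Tendsto (fun t => S t (g t - g a)) (𝓝[K] a) (𝓝 0) := by
    have h3 : Tendsto (fun t => M * ‖g t - g a‖) (𝓝[K] a) (𝓝 0) := by
      have h4 : Tendsto g (𝓝[K] a) (𝓝 (g a)) := hg a ha
      have := ((h4.sub_const (g a)).norm).const_mul M
      simpa using this
    refine squeeze_zero_norm' ?_ h3
    filter_upwards [self_mem_nhdsWithin] with t ht
    exact (S t).le_of_opNorm_le (hb t (hK ht)) _
  have := h2.add h1
  simp only [map_sub, sub_add_cancel, zero_add] at this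
  exact this

/-- if a mild solution of an exponentially stable positive semigroup
converges as `t → ∞`, then the limit is an equilibrium:
`u_∞ = ∫₀^∞ S(s)F(u_∞) ds` (i.e. `A u_∞ = F(u_∞)`). -/
theorem limit_of_mild_solution_is_equilibrium
    {E : Type*} [NormedAddCommGroup E] [NormedSpace ℝ E] [CompleteSpace E]
    (P : Set E) (S : ℝ → E →L[ℝ] E) (F : E → E) (ua ub : E)
    (hP : IsProperCone P) (hN : IsNormalCone P) (hS : IsPositiveSemigroup P S)
    (M ω : ℝ) (hM : 1 ≤ M) (hω : 0 < ω)
    (hstab : ∀ t : ℝ, 0 ≤ t → ‖S t‖ ≤ M * Real.exp (-ω * t))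
    (hab : coneLE P ua ub)
    (hFc : ContinuousOn F (orderInterval P ua ub))
    (hFm : ∀ x ∈ orderInterval P ua ub, ∀ y ∈ orderInterval P ua ub,
      coneLE P x y → coneLE P (F x) (F y))
    (u : ℝ → E) (hu : IsMildSolution P S F ua ub (u 0) u)
    (uinf : E) (hconv : Filter.Tendsto u Filter.atTop (nhds uinf)) :
    uinf = ∫ s in Set.Ioi (0:ℝ), S s (F uinf) := by
  obtain ⟨⟨-, -, hc⟩, -⟩ := hS
  obtain ⟨huc, hui, hum⟩ := hu
  have hM0 : 0 ≤ M := by linarith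
  have hb : ∀ t : ℝ, 0 ≤ t → ‖S t‖ ≤ M := by
    intro t ht
    refine (hstab t ht).trans ?_
    have : Real.exp (-ω * t) ≤ 1 := Real.exp_le_one_iff.2 (by nlinarith)
    nlinarith
  have h0 : (0 : E) ∈ P := by
    have := hP.2.2.1 0 le_rfl _ hab
    simpa using this
  have hua : ua ∈ orderInterval P ua ub := ⟨by simpa [coneLE] using h0, hab⟩
  have hub : ub ∈ orderInterval P ua ub := ⟨hab, by simpa [coneLE] using h0⟩
  have hinf : uinf ∈ orderInterval P ua ub := by
    have hev : ∀ᶠ t in atTop, u t ∈ orderInterval P ua ub := by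
      filter_upwards [eventually_ge_atTop 0] with t ht using hui t ht
    exact ⟨hP.1.mem_of_tendsto (hconv.sub_const ua) (hev.mono fun t h => h.1),
      hP.1.mem_of_tendsto (hconv.const_sub ub) (hev.mono fun t h => h.2)⟩
  obtain ⟨C, hC⟩ := hN (F ua) (F ub)
  have hFb : ∀ x ∈ orderInterval P ua ub, ‖F x‖ ≤ C := fun x hx =>
    hC _ ⟨hFm _ hua _ hx hx.1, hFm _ hx _ hub hx.2⟩
  have hC0 : 0 ≤ C := (norm_nonneg _).trans (hFb _ hua)
  have hFu : Tendsto (fun t => F (u t)) atTop (𝓝 (F uinf)) := by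
    have h1 : Tendsto F (𝓝[orderInterval P ua ub] uinf) (𝓝 (F uinf)) := hFc uinf hinf
    refine h1.comp (tendsto_nhdsWithin_iff.2 ⟨hconv, ?_⟩)
    filter_upwards [eventually_ge_atTop 0] with t ht using hui t ht
  have hFuc : ContinuousOn (fun t => F (u t)) (Set.Ici 0) :=
    hFc.comp huc (fun t ht => hui t ht)
  have hexp : Tendsto (fun t : ℝ => Real.exp (-ω * t)) atTop (𝓝 0) := by
    refine Real.tendsto_exp_atBot.comp ?_
    exact tendsto_id.const_mul_atTop_of_neg (by linarith)
  have hS0 : Tendsto (fun t => S t (u 0)) atTop (𝓝 0) := by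
    have h3 : Tendsto (fun t => M * Real.exp (-ω * t) * ‖u 0‖) atTop (𝓝 0) := by
      simpa using (hexp.const_mul M).mul_const ‖u 0‖
    refine squeeze_zero_norm' ?_ h3
    filter_upwards [eventually_ge_atTop 0] with t ht
    exact (S t).le_of_opNorm_le (hstab t ht) _
  have hlim : Tendsto (fun t : ℝ => ∫ r in Set.Ioi (0:ℝ),
      (Set.Ioc 0 t).indicator (fun r => S r (F (u (t - r)))) r) atTop
      (𝓝 (∫ r in Set.Ioi (0:ℝ), S r (F uinf))) := by
    refine tendsto_integral_filter_of_dominated_convergence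
      (fun r => M * Real.exp (-ω * r) * C) ?_ ?_ ?_ ?_
    · refine Eventually.of_forall fun t => ?_
      refine AEStronglyMeasurable.mono_measure ?_ Measure.restrict_le_self
      rw [aestronglyMeasurable_indicator_iff measurableSet_Ioc]
      refine ContinuousOn.aestronglyMeasurable ?_ measurableSet_Ioc
      refine aux_cont_s12 S M hb hc _ (fun r hr => hr.1.le) (fun r => F (u (t - r))) ?_
      exact hFuc.comp (continuous_const.sub continuous_id).continuousOn
        (fun r hr => sub_nonneg.2 hr.2)
    · refine Eventually.of_forall fun t => ?_
      filter_upwards [ae_restrict_mem measurableSet_Ioi] with r hr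
      by_cases h : r ∈ Set.Ioc 0 t
      · rw [Set.indicator_of_mem h]
        refine ((S r).le_of_opNorm_le (hstab r h.1.le) _).trans ?_
        exact mul_le_mul_of_nonneg_left (hFb _ (hui _ (sub_nonneg.2 h.2))) (by positivity)
      · rw [Set.indicator_of_notMem h, norm_zero]
        positivity
    · exact ((integrableOn_exp_mul_Ioi (by linarith) 0).const_mul M).mul_const C
    · filter_upwards [ae_restrict_mem measurableSet_Ioi] with r hr
      have h1 : Tendsto (fun t : ℝ => S r (F (u (t - r)))) atTop (𝓝 (S r (F uinf))) :=
        ((S r).continuous.tendsto _).comp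
          (hFu.comp (tendsto_atTop_add_const_right atTop (-r) tendsto_id))
      refine h1.congr' ?_
      filter_upwards [eventually_ge_atTop r] with t ht
      rw [Set.indicator_of_mem (show r ∈ Set.Ioc 0 t from ⟨hr, ht⟩)]
  have hsum := hS0.add hlim
  rw [zero_add] at hsum
  refine tendsto_nhds_unique hconv (hsum.congr' ?_)
  filter_upwards [eventually_ge_atTop 0] with t ht
  rw [hum t ht, fixedPointMap]
  congr 1
  have h5 := intervalIntegral.integral_comp_sub_left
    (a := 0) (b := t) (fun r => S r (F (u (t - r)))) t
  simp only [sub_sub_cancel, sub_self, sub_zero] at h5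
  rw [h5, intervalIntegral.integral_of_le ht, setIntegral_indicator measurableSet_Ioc,
    Set.inter_eq_self_of_subset_right (fun r hr => hr.1)]
end
end

section
/- Let E be an ordered Banach space and let p ∈ [1,∞) be such that ‖u + v‖^p = ‖u‖^p + ‖v‖^p for all u, v ∈ E₊. Then every increasing order-bounded sequence in E₊ converges: if (xₙ) is a sequence in E with 0 ≤ xₙ ≤ x_{n+1} ≤ b for all n and some b ∈ E, then (xₙ) converges in norm in E. In particular, E has order continuous norm. -/
noncomputable section

/-- if the norm is `p`-additive on the cone, i.e.
`‖u + v‖^p = ‖u‖^p + ‖v‖^p` for `u, v ∈ E₊`, then every increasing order-bounded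
sequence in `E₊` converges; in particular `E` has order continuous norm. -/
theorem orderContinuousNorm_of_p_additive
    {E : Type*} [NormedAddCommGroup E] [NormedSpace ℝ E] [CompleteSpace E]
    (P : Set E) (hP : IsProperCone P)
    (p : ℝ) (hp : 1 ≤ p)
    (hadd : ∀ u ∈ P, ∀ v ∈ P, ‖u + v‖ ^ p = ‖u‖ ^ p + ‖v‖ ^ p) :
    (∀ (x : ℕ → E) (b : E), (∀ n, x n ∈ P) → (∀ n, coneLE P (x n) (x (n + 1))) →
      (∀ n, coneLE P (x n) b) → ∃ l : E, Filter.Tendsto x Filter.atTop (nhds l)) ∧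
    OrderContinuousNorm P := by
  obtain ⟨_, hPadd, hPsmul, _⟩ := hP
  have hp0 : 0 < p := by linarith
  have key : ∀ (x : ℕ → E) (b : E), (∀ n, x n ∈ P) → (∀ n, coneLE P (x n) (x (n + 1))) →
      (∀ n, coneLE P (x n) b) → ∃ l : E, Filter.Tendsto x Filter.atTop (nhds l) := by
    intro x b hx hinc hb
    have hdiff : ∀ n m, n ≤ m → x m - x n ∈ P := by
      intro n m hnm
      induction m, hnm using Nat.le_induction with
      | base => simpa using hPsmul 0 le_rfl _ (hx 0)
      | succ m _ ih =>
        have h := hPadd _ (hinc m) _ ih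
        simpa using h
    have hf : ∀ n m, n ≤ m → ‖x m‖ ^ p = ‖x n‖ ^ p + ‖x m - x n‖ ^ p := by
      intro n m hnm
      have h := hadd _ (hx n) _ (hdiff n m hnm)
      simpa using h
    have hmono : Monotone (fun n => ‖x n‖ ^ p) := by
      intro n m hnm
      have h := hf n m hnm
      have h2 : 0 ≤ ‖x m - x n‖ ^ p := by positivity
      simp only
      linarith
    have hbdd : BddAbove (Set.range (fun n => ‖x n‖ ^ p)) := by
      refine ⟨‖b‖ ^ p, ?_⟩
      rintro _ ⟨n, rfl⟩
      have h := hadd _ (hx n) _ (hb n)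
      have h2 : 0 ≤ ‖b - x n‖ ^ p := by positivity
      simp only [add_sub_cancel] at h
      simp only
      linarith
    have hC := (tendsto_atTop_ciSup hmono hbdd).cauchySeq
    apply cauchySeq_tendsto_of_complete
    rw [Metric.cauchySeq_iff'] at hC ⊢
    intro ε hε
    obtain ⟨N, hN⟩ := hC (ε ^ p) (by positivity)
    refine ⟨N, fun n hn => ?_⟩
    have h1 := hN n hn
    rw [Real.dist_eq] at h1
    have h2 := lt_of_le_of_lt (le_abs_self _) h1
    have h3 := hf N n hn
    rw [dist_eq_norm]
    refine (Real.rpow_lt_rpow_iff (norm_nonneg _) hε.le hp0).1 ?_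
    linarith
  refine ⟨key, ?_⟩
  intro x a b hinc hx
  obtain ⟨l, hl⟩ := key (fun n => x n - a) (b - a) (fun n => (hx n).1)
    (fun n => by simpa [coneLE] using hinc n) (fun n => by simpa [coneLE] using (hx n).2)
  exact ⟨l + a, by simpa using hl.add_const a⟩
end
end
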